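/- arXiv:1503.01758 — 13 statements merged into one kernel-verified Lean document; each statement's English description precedes it below -/
import Mathlib

section
/- For every real number x ≥ 0 and all integers v, δ with v ≥ 3 and 1 < δ < v - 1, one has (x(v-1) - δ(δ-1))² + 4(v-δ-1)·δ·(v - 2δ + x) > 0. -/
/-- For every real `x ≥ 0` and all integers `v, δ` with `v ≥ 3` and `1 < δ < v - 1`,
`(x(v-1) - δ(δ-1))² + 4(v-δ-1)·δ·(v - 2δ + x) > 0`. -/
theorem positivity_under_the_root (x : ℝ) (hx : 0 ≤ x) (v δ : ℤ)
    (hv : 3 ≤ v) (hδ₁ : 1 < δ) (hδ₂ : δ < v - 1) :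
    (x * ((v : ℝ) - 1) - (δ : ℝ) * ((δ : ℝ) - 1)) ^ 2 +
      4 * ((v : ℝ) - (δ : ℝ) - 1) * (δ : ℝ) * ((v : ℝ) - 2 * (δ : ℝ) + x) > 0 := by
  have hd : (0 : ℝ) < δ := by exact_mod_cast (by lia : (0 : ℤ) < δ)
  have hk : (0 : ℝ) < v - δ - 1 := by exact_mod_cast (by lia : (0 : ℤ) < v - δ - 1)
  have hm : (0 : ℝ) < v - 1 := by linarith
  refine pos_of_mul_pos_right (a := ((v : ℝ) - 1) ^ 2) ?_ (sq_nonneg _)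
  -- completing the square in `x`
  have key : ((v : ℝ) - 1) ^ 2 * ((x * ((v : ℝ) - 1) - (δ : ℝ) * ((δ : ℝ) - 1)) ^ 2 +
      4 * ((v : ℝ) - (δ : ℝ) - 1) * (δ : ℝ) * ((v : ℝ) - 2 * (δ : ℝ) + x)) =
      (((v : ℝ) - 1) * (x * ((v : ℝ) - 1) - δ * ((δ : ℝ) - 1)) + 2 * ((v : ℝ) - δ - 1) * δ) ^ 2 +
      4 * ((v : ℝ) - δ - 1) ^ 3 * δ * (((v : ℝ) - 1) + 1) := by ring
  rw [key]
  positivity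
end

section
/- Let v ≥ 3 and 1 < δ < v - 1 be integers, and let G be a δ-regular simple graph on v vertices. Let u be a vertex of G whose neighbourhood graph G_u is connected, and let d̄ be the average degree of G_u. Then the second largest eigenvalue ν₂(G) of the adjacency matrix of G satisfies ν₂(G) ≥ F(d̄), where F(x) = [x(v-1) - δ(δ-1) + √((x(v-1) - δ(δ-1))² + 4(v-δ-1)δ(v-2δ+x))] / (2(v-δ-1)). -/
open scoped Classical

noncomputable section

/-- The second largest element (counted with multiplicity) of a finite family of reals. -/
def secondLargest {n : Type*} [Fintype n] (f : n → ℝ) : ℝ :=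
  sSup {x : ℝ | ∃ i j : n, i ≠ j ∧ x = min (f i) (f j)}

/-- The second smallest element (counted with multiplicity) of a finite family of reals. -/
def secondSmallest {n : Type*} [Fintype n] (f : n → ℝ) : ℝ :=
  sInf {x : ℝ | ∃ i j : n, i ≠ j ∧ x = max (f i) (f j)}

theorem adjMatrix_isHermitian {V : Type*} [Fintype V] (G : SimpleGraph V) :
    (G.adjMatrix ℝ).IsHermitian := by
  rw [Matrix.IsHermitian, Matrix.conjTranspose_eq_transpose_of_trivial]
  exact G.isSymm_adjMatrix

/-- The second largest eigenvalue `ν₂` of the adjacency matrix of a finite graph. -/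
def nu2 {V : Type*} [Fintype V] [DecidableEq V] (G : SimpleGraph V) : ℝ :=
  secondLargest (adjMatrix_isHermitian G).eigenvalues

/-- The algebraic connectivity of a finite graph: the second smallest eigenvalue of its
Laplacian matrix. -/
def algebraicConnectivity {V : Type*} [Fintype V] [DecidableEq V] (G : SimpleGraph V) : ℝ :=
  secondSmallest (SimpleGraph.posSemidef_lapMatrix ℝ G).1.eigenvalues

/-- The neighbourhood graph of a vertex `u`: the subgraph of `G` induced on the set of
neighbours of `u`. -/
abbrev nbhdGraph {V : Type*} (G : SimpleGraph V) (u : V) : SimpleGraph (G.neighborSet u) :=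
  G.induce (G.neighborSet u)

/-- The average degree of a finite graph: the sum of the degrees of its vertices divided by
the number of its vertices. -/
def avgDegree {W : Type*} [Fintype W] (H : SimpleGraph W) : ℝ :=
  (∑ w, (H.degree w : ℝ)) / (Fintype.card W : ℝ)

/-- The average degree of a connected component `C` of a finite graph `H`: the sum of the
degrees (taken within `H`) of the vertices of `C` divided by the number of vertices of `C`. -/
def compAvgDegree {W : Type*} [Fintype W] (H : SimpleGraph W) (C : H.ConnectedComponent) : ℝ :=
  (∑ w ∈ C.supp.toFinset, (H.degree w : ℝ)) / (C.supp.toFinset.card : ℝ)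

/-- The function `F` of the paper (for parameters `v`, `δ`). -/
def F (v δ x : ℝ) : ℝ :=
  (x * (v - 1) - δ * (δ - 1) +
      Real.sqrt ((x * (v - 1) - δ * (δ - 1)) ^ 2 + 4 * (v - δ - 1) * δ * (v - 2 * δ + x))) /
    (2 * (v - δ - 1))

end

open Matrix

/-- Every pair of distinct indices bounds the second largest element from below. -/
theorem min_le_secondLargest {n : Type*} [Fintype n] (f : n → ℝ) {i j : n} (hij : i ≠ j) :
    min (f i) (f j) ≤ secondLargest f := by
  refine le_csSup (Set.Finite.bddAbove ?_) ⟨i, j, hij, rfl⟩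
  refine (Set.finite_range fun p : n × n => min (f p.1) (f p.2)).subset ?_
  rintro x ⟨i, j, -, rfl⟩
  exact ⟨(i, j), rfl⟩

section Spectral

variable {n : Type*} [Fintype n] [DecidableEq n] {A : Matrix n n ℝ}

theorem dotProduct_self_eq_sum_eigenvectorBasis (hA : A.IsHermitian) (z : n → ℝ) :
    z ⬝ᵥ z = ∑ i, ((hA.eigenvectorBasis i).ofLp ⬝ᵥ z) ^ 2 := by
  have h := hA.eigenvectorBasis.sum_inner_mul_inner (WithLp.toLp 2 z) (WithLp.toLp 2 z)
  simp only [EuclideanSpace.inner_eq_star_dotProduct, star_trivial] at h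
  rw [← h]
  refine Finset.sum_congr rfl fun i _ => ?_
  rw [dotProduct_comm z, sq]

theorem dotProduct_mulVec_self_eq_sum_eigenvalues (hA : A.IsHermitian) (z : n → ℝ) :
    z ⬝ᵥ A *ᵥ z = ∑ i, hA.eigenvalues i * ((hA.eigenvectorBasis i).ofLp ⬝ᵥ z) ^ 2 := by
  have h := hA.eigenvectorBasis.sum_inner_mul_inner (WithLp.toLp 2 z) (WithLp.toLp 2 (A *ᵥ z))
  simp only [EuclideanSpace.inner_eq_star_dotProduct, star_trivial] at h
  rw [dotProduct_comm, ← h]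
  refine Finset.sum_congr rfl fun i _ => ?_
  have hT : Aᵀ = A := by rw [← conjTranspose_eq_transpose_of_trivial]; exact hA
  rw [dotProduct_comm (A *ᵥ z), dotProduct_mulVec, ← mulVec_transpose, hT,
    hA.mulVec_eigenvectorBasis, smul_dotProduct, smul_eq_mul]
  ring

/-- If the quadratic form of a real symmetric matrix is at least `θ` on the plane spanned by
two vectors, then the second largest eigenvalue is at least `θ`. -/
theorem le_secondLargest_eigenvalues (hA : A.IsHermitian) {θ : ℝ} {x y : n → ℝ}
    (hxy : ∀ a b : ℝ, a • x + b • y = 0 → a = 0 ∧ b = 0)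
    (hθ : ∀ a b : ℝ, θ * ((a • x + b • y) ⬝ᵥ (a • x + b • y)) ≤
      (a • x + b • y) ⬝ᵥ A *ᵥ (a • x + b • y)) :
    θ ≤ secondLargest hA.eigenvalues := by
  by_contra! hlt
  have hne : Nonempty n := by
    by_contra h
    rw [not_nonempty_iff] at h
    exact one_ne_zero (hxy 1 1 (Subsingleton.elim _ _)).1
  obtain ⟨i, hi⟩ : ∃ i, ∀ j, j ≠ i → hA.eigenvalues j < θ := by
    by_cases h : ∃ i, θ ≤ hA.eigenvalues i
    · obtain ⟨i, hi⟩ := h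
      refine ⟨i, fun j hj => ?_⟩
      by_contra! hj'
      exact absurd ((le_min hj' hi).trans (min_le_secondLargest _ hj)) hlt.not_ge
    · push Not at h
      exact ⟨hne.some, fun j _ => h j⟩
  set e := (hA.eigenvectorBasis i).ofLp with he
  obtain ⟨a, b, hab, horth⟩ : ∃ a b : ℝ, ¬ (a = 0 ∧ b = 0) ∧ e ⬝ᵥ (a • x + b • y) = 0 := by
    by_cases h : e ⬝ᵥ x = 0
    · exact ⟨1, 0, by simp, by simp [h]⟩
    · refine ⟨e ⬝ᵥ y, -(e ⬝ᵥ x), by simp [h], ?_⟩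
      simp only [dotProduct_add, dotProduct_smul, smul_eq_mul]
      ring
  have hz := hθ a b
  set z := a • x + b • y with hzdef
  have hz0 : 0 < z ⬝ᵥ z := by
    refine lt_of_le_of_ne ?_ fun h => hab (hxy a b (dotProduct_self_eq_zero.mp h.symm))
    exact Finset.sum_nonneg fun k _ => mul_self_nonneg (z k)
  rw [dotProduct_mulVec_self_eq_sum_eigenvalues hA] at hz
  rw [dotProduct_self_eq_sum_eigenvectorBasis hA] at hz hz0
  rw [Finset.mul_sum] at hz
  obtain ⟨j, -, hj⟩ := Finset.exists_ne_zero_of_sum_ne_zero hz0.ne'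
  have hji : j ≠ i := by
    rintro rfl
    exact hj (by rw [← he, horth]; simp)
  refine hz.not_gt (Finset.sum_lt_sum (fun k _ => ?_) ⟨j, Finset.mem_univ j, ?_⟩)
  · by_cases hk : k = i
    · subst hk
      simp [← he, horth]
    · exact mul_le_mul_of_nonneg_right (hi k hk).le (sq_nonneg _)
  · exact mul_lt_mul_of_pos_right (hi j hji) (lt_of_le_of_ne (sq_nonneg _) (Ne.symm hj))

end Spectral

section Neighbourhood

variable {V : Type*} [Fintype V] (G : SimpleGraph V)

/-- The quadratic form of the adjacency matrix, evaluated at the indicator vector of the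
neighbours of `u`, is the sum of the degrees of the neighbourhood graph of `u`. -/
theorem adjMatrix_row_dotProduct_mulVec_eq_sum_degree (u : V) :
    G.adjMatrix ℝ u ⬝ᵥ G.adjMatrix ℝ *ᵥ G.adjMatrix ℝ u =
      ∑ w, ((nbhdGraph G u).degree w : ℝ) := by
  have hdeg (w : G.neighborSet u) : ((nbhdGraph G u).degree w : ℝ) =
      (G.adjMatrix ℝ *ᵥ G.adjMatrix ℝ u) w := by
    rw [← SimpleGraph.card_neighborFinset_eq_degree, ← Finset.card_map (.subtype _),
      mulVec, dotProduct]
    simp only [SimpleGraph.adjMatrix_apply, ← ite_and, mul_ite, mul_one, mul_zero,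
      Finset.sum_boole]
    congr 2
    ext x
    simp [and_comm]
  simp_rw [hdeg]
  rw [dotProduct]
  simp only [SimpleGraph.adjMatrix_apply, ite_mul, one_mul, zero_mul]
  rw [← Finset.sum_filter]
  refine (Finset.sum_subtype _ (fun x => ?_) _)
  simp

theorem avgDegree_le {W : Type*} [Fintype W] [Nonempty W] (H : SimpleGraph W) :
    avgDegree H ≤ Fintype.card W - 1 := by
  have hW : (0 : ℝ) < Fintype.card W := by exact_mod_cast Fintype.card_pos
  rw [avgDegree, div_le_iff₀ hW]
  calc ∑ w, (H.degree w : ℝ) ≤ ∑ _w : W, ((Fintype.card W : ℝ) - 1) := by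
        refine Finset.sum_le_sum fun w _ => ?_
        have h := H.degree_lt_card_verts w
        rw [le_sub_iff_add_le]
        exact_mod_cast h
    _ = _ := by rw [Finset.sum_const, nsmul_eq_mul, Finset.card_univ, mul_comm]

end Neighbourhood

section Quadratic

variable {v δ x : ℝ}

/-- `F v δ x` is a root of the nonprincipal factor of the characteristic polynomial of the
quotient matrix. -/
theorem F_quadratic (hδ₀ : 0 < δ) (hδ : δ < v - 1) :
    (v - δ - 1) * F v δ x ^ 2 - (x * (v - 1) - δ * (δ - 1)) * F v δ x
      - δ * (v - 2 * δ + x) = 0 := by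
  have hm : v - δ - 1 ≠ 0 := by linarith
  have hv : 0 < v - 1 := by linarith
  have hD : 0 ≤ (x * (v - 1) - δ * (δ - 1)) ^ 2 + 4 * (v - δ - 1) * δ * (v - 2 * δ + x) := by
    have hpos : 0 ≤ (v - 1) * (v - δ) - δ := by nlinarith
    refine nonneg_of_mul_nonneg_right (a := (v - 1) ^ 2) ?_ (by positivity)
    calc 0 ≤ ((v - 1) * (x * (v - 1) - δ * (δ - 1)) + 2 * (v - δ - 1) * δ) ^ 2 +
          4 * (v - δ - 1) ^ 2 * δ * ((v - 1) * (v - δ) - δ) := by positivity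
      _ = _ := by ring
  have hsq := Real.sq_sqrt hD
  unfold F
  set s := √((x * (v - 1) - δ * (δ - 1)) ^ 2 + 4 * (v - δ - 1) * δ * (v - 2 * δ + x))
  field_simp
  linear_combination hsq

theorem F_le (hδ₀ : 0 < δ) (hδ : δ < v - 1) (hx : x ≤ δ - 1) : F v δ x ≤ δ := by
  have hm : 0 < v - δ - 1 := by linarith
  have hv : 0 < v := by linarith
  unfold F
  rw [div_le_iff₀ (by positivity)]
  have hS : x * (v - 1) - δ * (δ - 1) ≤ δ * (v - δ - 1) := by nlinarith
  have hs : √((x * (v - 1) - δ * (δ - 1)) ^ 2 + 4 * (v - δ - 1) * δ * (v - 2 * δ + x)) ≤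
      2 * (v - δ - 1) * δ - (x * (v - 1) - δ * (δ - 1)) := by
    refine Real.sqrt_le_iff.mpr ⟨by nlinarith, ?_⟩
    have : 0 ≤ (v - δ - 1) * (δ * v) * (δ - 1 - x) :=
      mul_nonneg (by positivity) (by linarith)
    linarith
  linarith

end Quadratic

/-- lower bound on `ν₂` coming from a vertex with connected
neighbourhood graph. -/
theorem nu2_ge_of_connected_neighbourhood
    {V : Type*} [Fintype V] [DecidableEq V] (v δ : ℕ) (hv : 3 ≤ v)
    (hδ₁ : 1 < δ) (hδ₂ : (δ : ℤ) < (v : ℤ) - 1)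
    (hcard : Fintype.card V = v) (G : SimpleGraph V) (hreg : G.IsRegularOfDegree δ)
    (u : V) (hconn : (nbhdGraph G u).Connected) :
    F (v : ℝ) (δ : ℝ) (avgDegree (nbhdGraph G u)) ≤ nu2 G := by
  have hδ₀ : (0 : ℝ) < δ := by exact_mod_cast (by lia : 0 < δ)
  have hδv : (δ : ℝ) < v - 1 := by exact_mod_cast hδ₂
  have hdeg (w : V) : ∑ x, G.adjMatrix ℝ w x = δ := by
    have h := hreg w
    simp only [SimpleGraph.adjMatrix_apply, Finset.sum_boole, ← h,
      ← SimpleGraph.card_neighborFinset_eq_degree]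
    congr 2
    ext x
    simp
  have hN : Fintype.card (G.neighborSet u) = δ := by
    rw [SimpleGraph.card_neighborSet_eq_degree, ← hreg u]
  have hne : Nonempty (G.neighborSet u) := hconn.nonempty
  have hNAN := adjMatrix_row_dotProduct_mulVec_eq_sum_degree G u
  have havg : ∑ w, ((nbhdGraph G u).degree w : ℝ) = δ * avgDegree (nbhdGraph G u) := by
    rw [avgDegree, hN, mul_div_cancel₀ _ hδ₀.ne']
    congr!
  rw [havg] at hNAN
  have hd : avgDegree (nbhdGraph G u) ≤ δ - 1 := by
    have h := avgDegree_le (nbhdGraph G u)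
    rwa [hN] at h
  generalize avgDegree (nbhdGraph G u) = d at *
  have hquad := F_quadratic (x := d) hδ₀ hδv
  have hFle := F_le hδ₀ hδv hd
  generalize F (v : ℝ) (δ : ℝ) d = θ at *
  set N := G.adjMatrix ℝ u with hNdef
  have hT : (G.adjMatrix ℝ)ᵀ = G.adjMatrix ℝ := G.isSymm_adjMatrix
  set e : V → ℝ := Pi.single u 1 with he
  have hAo : G.adjMatrix ℝ *ᵥ 1 = (δ : ℝ) • 1 := by
    ext w
    rw [mulVec, dotProduct_one, hdeg]
    simp
  have hAe : G.adjMatrix ℝ *ᵥ e = N := by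
    rw [he, mulVec_single_one, ← row_transpose, hT]
    rfl
  have hoo : (1 : V → ℝ) ⬝ᵥ 1 = v := by simp [hcard]
  have heo : e ⬝ᵥ 1 = 1 := by simp [he]
  have hee : e ⬝ᵥ e = 1 := by simp [he]
  have hNo : N ⬝ᵥ 1 = δ := by rw [dotProduct_one, hdeg]
  have hNe : N ⬝ᵥ e = 0 := by simp [he, hNdef]
  have hNN : N ⬝ᵥ N = δ := by
    rw [← hdeg u]
    exact Finset.sum_congr rfl fun w _ => by simp [hNdef, SimpleGraph.adjMatrix_apply]
  have hsymm (p q : V → ℝ) : p ⬝ᵥ G.adjMatrix ℝ *ᵥ q = q ⬝ᵥ G.adjMatrix ℝ *ᵥ p := by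
    rw [dotProduct_mulVec, ← mulVec_transpose, hT, dotProduct_comm]
  have hm : (v : ℝ) - δ - 1 ≠ 0 := by linarith
  obtain ⟨c, hc⟩ : ∃ c : ℝ, c * (v - δ - 1) = -(δ * (1 + θ)) :=
    ⟨-(δ * (1 + θ)) / (v - δ - 1), div_mul_cancel₀ _ hm⟩
  -- the vector taking the values `δ`, `θ`, `c` at `u`, on its neighbours and elsewhere
  set y : V → ℝ := (δ - c) • e + (θ - c) • N + c • 1 with hy
  have hyo : y ⬝ᵥ 1 = 0 := by
    simp only [hy, add_dotProduct, smul_dotProduct, heo, hNo, hoo, smul_eq_mul]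
    linear_combination hc
  have hyu : y u = δ := by simp [hy, he, hNdef]
  have hoAy : 1 ⬝ᵥ G.adjMatrix ℝ *ᵥ y = 0 := by
    rw [hsymm, hAo, dotProduct_smul, hyo, smul_zero]
  have hyAy : y ⬝ᵥ G.adjMatrix ℝ *ᵥ y = θ * (y ⬝ᵥ y) := by
    have hN_row : δ + d * θ + (δ - 1 - d) * c - θ ^ 2 = 0 := by
      refine mul_left_cancel₀ hm ?_
      linear_combination (δ - 1 - d) * hc - hquad
    have hoN : (1 : V → ℝ) ⬝ᵥ G.adjMatrix ℝ *ᵥ N = δ * δ := by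
      rw [hsymm, hAo, dotProduct_smul, hNo, smul_eq_mul]
    have heN : e ⬝ᵥ G.adjMatrix ℝ *ᵥ N = δ := by rw [hsymm, hAe, hNN]
    simp only [hy, mulVec_add, mulVec_smul, add_dotProduct, smul_dotProduct, dotProduct_add,
      dotProduct_smul, hAe, hAo, heo, hee, hNo, hNe, hNN, hoo, hoN, heN, hNAN, smul_eq_mul,
      dotProduct_comm e N, dotProduct_comm 1 N, dotProduct_comm 1 e]
    linear_combination (θ - c) * δ * hN_row + c * (δ - θ) * hc
  refine le_secondLargest_eigenvalues (x := 1) (y := y) _ (fun a b hab => ?_) fun a b => ?_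
  · have ha : a = 0 := by
      have h := congrArg (· ⬝ᵥ (1 : V → ℝ)) hab
      simp only [add_dotProduct, smul_dotProduct, hoo, hyo, zero_dotProduct, smul_eq_mul,
        mul_zero, add_zero] at h
      exact (mul_eq_zero.mp h).resolve_right (by positivity)
    have h := congrFun hab u
    simpa [ha, hyu, hδ₀.ne'] using h
  · simp only [mulVec_add, mulVec_smul, add_dotProduct, smul_dotProduct, dotProduct_add,
      dotProduct_smul, hAo, hoo, hyo, hoAy, hyAy, dotProduct_comm 1 y, smul_eq_mul, mul_zero,
      add_zero, zero_add]
    have h : 0 ≤ (δ - θ) * (a ^ 2 * v) :=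
      mul_nonneg (sub_nonneg.mpr hFle) (by positivity)
    linarith
end

section
/- Let v ≥ 3 and 1 < δ < v - 1 be integers. Then the function F(x) = [x(v-1) - δ(δ-1) + √((x(v-1) - δ(δ-1))² + 4(v-δ-1)δ(v-2δ+x))] / (2(v-δ-1)) is strictly increasing on [0, ∞). -/
open scoped Classical

theorem strictMono_add_sqrt_sq_add {K : ℝ} (hK : 0 < K) :
    StrictMono fun t : ℝ => t + √(t ^ 2 + K) := by
  have pos (t : ℝ) : 0 < t + √(t ^ 2 + K) := by
    have : |t| < √(t ^ 2 + K) := Real.lt_sqrt_of_sq_lt (by rw [sq_abs]; linarith)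
    linarith [neg_abs_le t]
  have prod (t : ℝ) : (t + √(t ^ 2 + K)) * (√(t ^ 2 + K) - t) = K := by
    have : √(t ^ 2 + K) ^ 2 = t ^ 2 + K := Real.sq_sqrt (by positivity)
    linear_combination this
  intro s t hst
  by_contra! h
  have hlt : √(t ^ 2 + K) - t < √(s ^ 2 + K) - s := by
    linarith
  have hpos : 0 < √(s ^ 2 + K) - s := pos_of_mul_pos_right (by rw [prod]; exact hK) (pos s).le
  have := calc
    K = (t + √(t ^ 2 + K)) * (√(t ^ 2 + K) - t) := (prod t).symm
    _ < (t + √(t ^ 2 + K)) * (√(s ^ 2 + K) - s) := mul_lt_mul_of_pos_left hlt (pos t)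
    _ ≤ (s + √(s ^ 2 + K)) * (√(s ^ 2 + K) - s) := mul_le_mul_of_nonneg_right h hpos.le
    _ = K := prod s
  exact this.false

/-- Completing the square in the discriminant. -/
theorem F_discriminant_eq {v δ : ℝ} (hv : v - 1 ≠ 0) (x : ℝ) :
    (x * (v - 1) - δ * (δ - 1)) ^ 2 + 4 * (v - δ - 1) * δ * (v - 2 * δ + x) =
      (x * (v - 1) - δ * (δ - 1) + 2 * (v - δ - 1) * δ / (v - 1)) ^ 2 +
        4 * (v - δ - 1) ^ 3 * δ * v / (v - 1) ^ 2 := by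
  field_simp
  ring

theorem F_strictMono {v δ : ℝ} (hδ : 0 < δ) (hv : δ < v - 1) : StrictMono (F v δ) := by
  have ha : 0 < v - 1 := hδ.trans hv
  have hc : 0 < v - δ - 1 := by linarith
  have hv' : 0 < v := by linarith
  have hK : 0 < 4 * (v - δ - 1) ^ 3 * δ * v / (v - 1) ^ 2 := by positivity
  intro x y hxy
  have h := strictMono_add_sqrt_sq_add hK
    (show x * (v - 1) - δ * (δ - 1) + 2 * (v - δ - 1) * δ / (v - 1) <
      y * (v - 1) - δ * (δ - 1) + 2 * (v - δ - 1) * δ / (v - 1) by gcongr)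
  simp only [← F_discriminant_eq ha.ne'] at h
  unfold F
  refine div_lt_div_of_pos_right ?_ (by positivity)
  linarith

/-- `F` is strictly increasing on `[0, ∞)`. -/
theorem F_strictMonoOn (v δ : ℤ) (hv : 3 ≤ v) (hδ₁ : 1 < δ) (hδ₂ : δ < v - 1) :
    StrictMonoOn (F (v : ℝ) (δ : ℝ)) (Set.Ici (0 : ℝ)) := by
  have h₁ : (1 : ℝ) < δ := by exact_mod_cast hδ₁
  have h₂ : (δ : ℝ) < v - 1 := by exact_mod_cast hδ₂
  exact (F_strictMono (by linarith) h₂).strictMonoOn _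
end

section
/- Let v ≥ 3 and 1 < δ < v - 1 be integers. Then the function F(x) = [x(v-1) - δ(δ-1) + √((x(v-1) - δ(δ-1))² + 4(v-δ-1)δ(v-2δ+x))] / (2(v-δ-1)) is strictly convex on [0, ∞). -/
open scoped Classical

/-- The square root of a real quadratic polynomial with negative discriminant and positive leading
coefficient is strictly convex. -/
theorem strictConvexOn_sqrt_quadratic {a b c : ℝ} (ha : 0 < a) (h : b ^ 2 < 4 * a * c) :
    StrictConvexOn ℝ Set.univ fun x : ℝ => Real.sqrt (a * x ^ 2 + b * x + c) := by
  have pos (x : ℝ) : 0 < a * x ^ 2 + b * x + c := by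
    have key : 4 * a * (a * x ^ 2 + b * x + c) = (2 * a * x + b) ^ 2 + (4 * a * c - b ^ 2) := by
      ring
    have : 0 < 4 * a * (a * x ^ 2 + b * x + c) := by
      rw [key]
      linarith [sq_nonneg (2 * a * x + b)]
    exact pos_of_mul_pos_right this (by positivity)
  refine ⟨convex_univ, fun x _ y _ hxy α β hα hβ hαβ => ?_⟩
  simp only [smul_eq_mul]
  have hs := Real.sq_sqrt (pos x).le
  have ht := Real.sq_sqrt (pos y).le
  have hs₀ := Real.sqrt_pos.2 (pos x)
  have ht₀ := Real.sqrt_pos.2 (pos y)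
  set s := Real.sqrt (a * x ^ 2 + b * x + c)
  set t := Real.sqrt (a * y ^ 2 + b * y + c)
  have polar_lt : a * x * y + b * (x + y) / 2 + c < s * t := by
    refine lt_of_pow_lt_pow_left₀ 2 (by positivity) ?_
    rw [mul_pow, hs, ht]
    have := mul_pos (sub_pos.2 h) (sq_pos_of_ne_zero (sub_ne_zero.2 hxy))
    linear_combination this / 4
  rw [Real.sqrt_lt' (by positivity)]
  obtain rfl : β = 1 - α := by linarith
  have := mul_lt_mul_of_pos_left polar_lt (mul_pos hα hβ)
  linear_combination 2 * this - α ^ 2 * hs - (1 - α) ^ 2 * ht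

/-- `F` is strictly convex on `[0, ∞)`. -/
theorem F_strictConvexOn (v δ : ℤ) (hv : 3 ≤ v) (hδ₁ : 1 < δ) (hδ₂ : δ < v - 1) :
    StrictConvexOn ℝ (Set.Ici (0 : ℝ)) (F (v : ℝ) (δ : ℝ)) := by
  have hv' : (3 : ℝ) ≤ v := by exact_mod_cast hv
  have hδ : (1 : ℝ) < δ := by exact_mod_cast hδ₁
  have hk : (0 : ℝ) < v - δ - 1 := by
    have : (δ : ℝ) < v - 1 := by exact_mod_cast hδ₂
    linarith
  generalize (v : ℝ) = v at *
  generalize (δ : ℝ) = δ at *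
  have hdisc : (4 * (v - δ - 1) * δ - 2 * (v - 1) * (δ * (δ - 1))) ^ 2 <
      4 * (v - 1) ^ 2 * ((δ * (δ - 1)) ^ 2 + 4 * (v - δ - 1) * δ * (v - 2 * δ)) := by
    have : 0 < 16 * v * δ * (v - δ - 1) ^ 3 := by positivity
    linear_combination this
  have hsqrt := strictConvexOn_sqrt_quadratic (pow_pos (by linarith : 0 < v - 1) 2) hdisc
  refine ⟨convex_Ici 0, fun x _ y _ hxy α β hα hβ hαβ => ?_⟩
  have key := hsqrt.2 (Set.mem_univ x) (Set.mem_univ y) hxy hα hβ hαβ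
  have hquad (z : ℝ) : (z * (v - 1) - δ * (δ - 1)) ^ 2 + 4 * (v - δ - 1) * δ * (v - 2 * δ + z) =
      (v - 1) ^ 2 * z ^ 2 + (4 * (v - δ - 1) * δ - 2 * (v - 1) * (δ * (δ - 1))) * z +
        ((δ * (δ - 1)) ^ 2 + 4 * (v - δ - 1) * δ * (v - 2 * δ)) := by
    ring
  simp only [F, hquad, smul_eq_mul] at key ⊢
  rw [← mul_div_assoc, ← mul_div_assoc, ← add_div]
  refine div_lt_div_of_pos_right ?_ (by positivity)
  linear_combination key + δ * (δ - 1) * hαβ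
end

section
/- Let v, δ be integers with v ≥ 3, 2 < δ < v - 1 and v ≤ 2δ, and let F(x) = [x(v-1) - δ(δ-1) + √((x(v-1) - δ(δ-1))² + 4(v-δ-1)δ(v-2δ+x))] / (2(v-δ-1)). Then F(x) ≤ x for all x in the interval [0, (δ - 2 + √((δ+2)² - 4v))/2], and F(x) > x for all x ≥ 0 outside this interval. -/
/-- On `[0, ∞)`, the larger root of a monic quadratic with nonpositive constant term separates
its nonpositive and positive values. -/
theorem le_largerRoot_iff {b c x : ℝ} (hc : c ≤ 0) (hx : 0 ≤ x) :
    x ≤ (b + Real.sqrt (b ^ 2 - 4 * c)) / 2 ↔ x ^ 2 - b * x + c ≤ 0 := by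
  have key : x ≤ (b + Real.sqrt (b ^ 2 - 4 * c)) / 2 ↔
      2 * x - b ≤ Real.sqrt (b ^ 2 - 4 * c) := by
    constructor <;> intro h <;> linarith
  rw [key]
  constructor
  · intro h
    have hs := Real.sq_sqrt (show 0 ≤ b ^ 2 - 4 * c by nlinarith [sq_nonneg b])
    have hb : b ≤ Real.sqrt (b ^ 2 - 4 * c) := Real.le_sqrt_of_sq_le (by nlinarith)
    have habs : (2 * x - b) ^ 2 ≤ Real.sqrt (b ^ 2 - 4 * c) ^ 2 :=
      sq_le_sq' (by linarith) h
    nlinarith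
  · intro h
    exact Real.le_sqrt_of_sq_le (by nlinarith)


open scoped Classical

/-- comparison of `F x` with `x` when `2 < δ < v - 1` and `v ≤ 2δ`. -/
theorem F_vs_id_of_v_le_two_delta (v δ : ℤ) (hv : 3 ≤ v) (hδ₁ : 2 < δ) (hδ₂ : δ < v - 1)
    (hvδ : v ≤ 2 * δ) :
    (∀ x : ℝ, x ∈ Set.Icc (0 : ℝ)
        (((δ : ℝ) - 2 + Real.sqrt (((δ : ℝ) + 2) ^ 2 - 4 * (v : ℝ))) / 2) →
      F (v : ℝ) (δ : ℝ) x ≤ x) ∧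
    (∀ x : ℝ, 0 ≤ x →
      x ∉ Set.Icc (0 : ℝ) (((δ : ℝ) - 2 + Real.sqrt (((δ : ℝ) + 2) ^ 2 - 4 * (v : ℝ))) / 2) →
      x < F (v : ℝ) (δ : ℝ) x) := by
  have hδ : (2 : ℝ) < δ := by exact_mod_cast hδ₁
  have hv_ge : (δ : ℝ) + 2 ≤ v := by exact_mod_cast (by omega : δ + 2 ≤ v)
  have hv_le : (v : ℝ) ≤ 2 * δ := by exact_mod_cast hvδ
  generalize (v : ℝ) = v at *
  generalize (δ : ℝ) = δ at *
  have ha : 0 < v - δ - 1 := by linarith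
  have hdisc : (δ + 2) ^ 2 - 4 * v = (δ - 2) ^ 2 - 4 * (v - 2 * δ) := by ring
  have hgap (x : ℝ) : (x * (v - 1) - δ * (δ - 1)) ^ 2 + 4 * (v - δ - 1) * δ * (v - 2 * δ + x) =
      (2 * (v - δ - 1) * x - (x * (v - 1) - δ * (δ - 1))) ^ 2 +
        4 * ((v - δ - 1) * δ) * (x ^ 2 - (δ - 2) * x + (v - 2 * δ)) := by ring
  have haδ : 0 < 4 * ((v - δ - 1) * δ) := by positivity
  simp only [Set.mem_Icc, hdisc]
  refine ⟨fun x ⟨hx, hxr⟩ => ?_, fun x hx hxr => ?_⟩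
  · have hQ := (le_largerRoot_iff (by linarith) hx).1 hxr
    have hxδ : x ≤ δ := by
      by_contra! h
      nlinarith
    have ht : 0 ≤ 2 * (v - δ - 1) * x - (x * (v - 1) - δ * (δ - 1)) := by
      nlinarith [mul_nonneg hx (sub_nonneg.2 hv_ge),
        mul_nonneg (sub_nonneg.2 hxδ) (by linarith : 0 ≤ δ - 1)]
    have hsqrt := Real.sqrt_le_iff.2 ⟨ht, (hgap x).trans_le
      (add_le_of_nonpos_right (mul_nonpos_of_nonneg_of_nonpos haδ.le hQ))⟩
    rw [F, div_le_iff₀ (by linarith)]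
    linarith
  · have hQ : 0 < x ^ 2 - (δ - 2) * x + (v - 2 * δ) := by
      by_contra! h
      exact hxr ⟨hx, (le_largerRoot_iff (by linarith) hx).2 h⟩
    have hsqrt := Real.lt_sqrt_of_sq_lt
      ((lt_add_of_pos_right _ (mul_pos haδ hQ)).trans_eq (hgap x).symm)
    rw [F, lt_div_iff₀ (by linarith)]
    linarith
end

section
/- Let v, δ be integers with 2 < δ < v - 1 and 2δ < v < (δ+2)²/4, and let F(x) = [x(v-1) - δ(δ-1) + √((x(v-1) - δ(δ-1))² + 4(v-δ-1)δ(v-2δ+x))] / (2(v-δ-1)). Then F(x) ≤ x for all x in the interval [(δ - 2 - √((δ+2)² - 4v))/2, (δ - 2 + √((δ+2)² - 4v))/2], and F(x) > x for all x ≥ 0 outside this interval. -/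
open scoped Classical

/-- The interval with endpoints `(b ± √D) / 2` is the solution set of `(2 * x - b) ^ 2 ≤ D`. -/
theorem mem_Icc_half_sqrt_iff {b D x : ℝ} (hD : 0 ≤ D) :
    x ∈ Set.Icc ((b - Real.sqrt D) / 2) ((b + Real.sqrt D) / 2) ↔ (2 * x - b) ^ 2 ≤ D := by
  rw [Real.sq_le hD, Set.mem_Icc]
  constructor <;> rintro ⟨h₁, h₂⟩ <;> constructor <;> linarith

/-- The larger root of `a * y ^ 2 - B * y - C` is at most `x > 0` if the polynomial is
nonnegative at `x`. -/
theorem quadratic_root_le {a B C x : ℝ} (ha : 0 < a) (hC : 0 ≤ C) (hx : 0 < x)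
    (h : 0 ≤ a * x ^ 2 - B * x - C) :
    (B + Real.sqrt (B ^ 2 + 4 * a * C)) / (2 * a) ≤ x := by
  have hax : 0 < a * x := mul_pos ha hx
  have hB : 0 ≤ a * x - B := by
    refine nonneg_of_mul_nonneg_left ?_ hx
    linarith [show (a * x - B) * x = a * x ^ 2 - B * x by ring]
  rw [div_le_iff₀ (by positivity)]
  have key : Real.sqrt (B ^ 2 + 4 * a * C) ≤ 2 * a * x - B := by
    refine Real.sqrt_le_iff.mpr ⟨by linarith, ?_⟩
    linarith [mul_nonneg ha.le h, show (2 * a * x - B) ^ 2 =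
      B ^ 2 + 4 * a * C + 4 * (a * (a * x ^ 2 - B * x - C)) by ring]
  linarith

/-- The larger root of `a * y ^ 2 - B * y - C` exceeds `x` if the polynomial is negative
at `x`. -/
theorem lt_quadratic_root {a B C x : ℝ} (ha : 0 < a) (h : a * x ^ 2 - B * x - C < 0) :
    x < (B + Real.sqrt (B ^ 2 + 4 * a * C)) / (2 * a) := by
  rw [lt_div_iff₀ (by positivity)]
  have key : 2 * a * x - B < Real.sqrt (B ^ 2 + 4 * a * C) := by
    refine Real.lt_sqrt_of_sq_lt ?_
    linarith [mul_neg_of_pos_of_neg ha h, show (2 * a * x - B) ^ 2 =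
      B ^ 2 + 4 * a * C + 4 * (a * (a * x ^ 2 - B * x - C)) by ring]
  linarith

/-- comparison of `F x` with `x` when `2 < δ < v - 1` and `2δ < v < (δ+2)²/4`. -/
theorem F_vs_id_of_middle_range (v δ : ℤ) (hδ₁ : 2 < δ) (hδ₂ : δ < v - 1)
    (hvδ : 2 * δ < v) (hv4 : 4 * v < (δ + 2) ^ 2) :
    (∀ x : ℝ, x ∈ Set.Icc
        (((δ : ℝ) - 2 - Real.sqrt (((δ : ℝ) + 2) ^ 2 - 4 * (v : ℝ))) / 2)
        (((δ : ℝ) - 2 + Real.sqrt (((δ : ℝ) + 2) ^ 2 - 4 * (v : ℝ))) / 2) →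
      F (v : ℝ) (δ : ℝ) x ≤ x) ∧
    (∀ x : ℝ, 0 ≤ x →
      x ∉ Set.Icc (((δ : ℝ) - 2 - Real.sqrt (((δ : ℝ) + 2) ^ 2 - 4 * (v : ℝ))) / 2)
        (((δ : ℝ) - 2 + Real.sqrt (((δ : ℝ) + 2) ^ 2 - 4 * (v : ℝ))) / 2) →
      x < F (v : ℝ) (δ : ℝ) x) := by
  have h₁ : (2 : ℝ) < δ := by exact_mod_cast hδ₁
  have h₂ : (δ : ℝ) < v - 1 := by exact_mod_cast hδ₂
  have h₃ : 2 * (δ : ℝ) < v := by exact_mod_cast hvδ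
  have h₄ : 4 * (v : ℝ) < (δ + 2) ^ 2 := by exact_mod_cast hv4
  have hδ : (0 : ℝ) < δ := by linarith
  have ha : (0 : ℝ) < v - δ - 1 := by linarith
  have hP (x : ℝ) : ((v : ℝ) - δ - 1) * x ^ 2 - (x * (v - 1) - δ * (δ - 1)) * x
      - δ * (v - 2 * δ + x) = δ / 4 * (((δ : ℝ) + 2) ^ 2 - 4 * v - (2 * x - (δ - 2)) ^ 2) := by
    ring
  have hF (x : ℝ) : F v δ x = ((x * (v - 1) - δ * (δ - 1)) +
      Real.sqrt ((x * (v - 1) - δ * (δ - 1)) ^ 2 +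
        4 * (v - δ - 1) * (δ * (v - 2 * δ + x)))) / (2 * (v - δ - 1)) := by
    rw [F, ← mul_assoc (4 * ((v : ℝ) - δ - 1))]
  constructor
  · intro x hx
    rw [mem_Icc_half_sqrt_iff (by linarith)] at hx
    have hx₀ : 0 < x := by
      by_contra! hx'
      nlinarith
    rw [hF]
    refine quadratic_root_le ha (mul_nonneg hδ.le (by linarith)) hx₀ ?_
    rw [hP]
    exact mul_nonneg (by linarith) (by linarith)
  · intro x _ hx
    rw [mem_Icc_half_sqrt_iff (by linarith), not_le] at hx
    rw [hF]
    refine lt_quadratic_root ha ?_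
    rw [hP]
    exact mul_neg_of_pos_of_neg (by linarith) (by linarith)
end

section
/- Let v, δ be integers with v ≥ 3, 1 < δ < v - 1 and 4v > (δ+2)², and let F(x) = [x(v-1) - δ(δ-1) + √((x(v-1) - δ(δ-1))² + 4(v-δ-1)δ(v-2δ+x))] / (2(v-δ-1)). Then F(x) > x for all x ≥ 0. -/
open scoped Classical

/-- `F x > x` for all `x ≥ 0` when `4v > (δ+2)²`. -/
theorem F_gt_id_of_large_v (v δ : ℤ) (hv : 3 ≤ v) (hδ₁ : 1 < δ) (hδ₂ : δ < v - 1)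
    (hv4 : (δ + 2) ^ 2 < 4 * v) :
    ∀ x : ℝ, 0 ≤ x → x < F (v : ℝ) (δ : ℝ) x := by
  intro x _
  have hδ : (1 : ℝ) < δ := by exact_mod_cast hδ₁
  have ha : (0 : ℝ) < v - δ - 1 := by
    have : (δ : ℝ) < v - 1 := by exact_mod_cast hδ₂
    linarith
  have hv' : ((δ : ℝ) + 2) ^ 2 < 4 * v := by exact_mod_cast hv4
  have hquad : (0 : ℝ) < x ^ 2 - (δ - 2) * x + (v - 2 * δ) := by
    nlinarith [sq_nonneg (2 * x - ((δ : ℝ) - 2))]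
  have hprod : (0 : ℝ) < 4 * (v - δ - 1) * δ * (x ^ 2 - (δ - 2) * x + (v - 2 * δ)) := by
    positivity
  have hroot := Real.lt_sqrt_of_sq_lt
    (show (2 * ((v : ℝ) - δ - 1) * x - (x * (v - 1) - δ * (δ - 1))) ^ 2 <
        (x * ((v : ℝ) - 1) - δ * (δ - 1)) ^ 2 + 4 * (v - δ - 1) * δ * (v - 2 * δ + x) by
      linarith)
  rw [F, lt_div_iff₀ (by linarith)]
  linarith
end

section
/- Let v, δ be integers with 2 < δ < v - 1 and 4v ≤ (δ+2)², and let F(x) = [x(v-1) - δ(δ-1) + √((x(v-1) - δ(δ-1))² + 4(v-δ-1)δ(v-2δ+x))] / (2(v-δ-1)). Then for each choice of sign, the number z = (δ - 2 ± √((δ+2)² - 4v))/2 satisfies F(z) = z whenever z ≥ 0. -/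
open scoped Classical

/-- the numbers `(δ - 2 ± √((δ+2)² - 4v))/2` are fixed points of `F`
whenever they are nonnegative. -/
theorem F_fixed_points (v δ : ℤ) (hδ₁ : 2 < δ) (hδ₂ : δ < v - 1)
    (hv4 : 4 * v ≤ (δ + 2) ^ 2) :
    ∀ s : ℝ, s = 1 ∨ s = -1 →
      ∀ z : ℝ, z = ((δ : ℝ) - 2 + s * Real.sqrt (((δ : ℝ) + 2) ^ 2 - 4 * (v : ℝ))) / 2 →
        0 ≤ z → F (v : ℝ) (δ : ℝ) z = z := by
  intro s hs z hz hz0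
  have hδ : (3 : ℝ) ≤ δ := by exact_mod_cast (show (3 : ℤ) ≤ δ by omega)
  have hv : (δ : ℝ) + 2 ≤ v := by exact_mod_cast (show δ + 2 ≤ v by omega)
  have hdisc : (0 : ℝ) ≤ ((δ : ℝ) + 2) ^ 2 - 4 * v := by
    have : (4 * v : ℝ) ≤ ((δ : ℝ) + 2) ^ 2 := by exact_mod_cast hv4
    linarith
  have hs2 : s ^ 2 = 1 := by rcases hs with rfl | rfl <;> norm_num
  have hroot : z ^ 2 - (δ - 2) * z + (v - 2 * δ) = 0 := by
    have hsq := Real.sq_sqrt hdisc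
    rw [hz]
    linear_combination (1 / 4) * √(((δ : ℝ) + 2) ^ 2 - 4 * v) ^ 2 * hs2 + (1 / 4) * hsq
  have hzlt : z < δ - 1 := by
    by_contra! h
    nlinarith [mul_nonneg (by linarith : (0 : ℝ) ≤ z + 1) (sub_nonneg.2 h)]
  have hnonneg : 0 ≤ z * (v - 2 * δ - 1) + δ * (δ - 1) := by
    nlinarith [mul_nonneg hz0 (sub_nonneg.2 hv),
      mul_nonneg (sub_nonneg.2 hzlt.le) (by linarith : (0 : ℝ) ≤ (δ : ℝ) - 1)]
  have hrad : (z * (v - 1) - δ * (δ - 1) : ℝ) ^ 2 + 4 * (v - δ - 1) * δ * (v - 2 * δ + z) =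
      (z * (v - 2 * δ - 1) + δ * (δ - 1)) ^ 2 := by
    linear_combination (4 * (v - δ - 1) * δ : ℝ) * hroot
  have hden : (2 * (v - δ - 1) : ℝ) ≠ 0 := by
    have : (0 : ℝ) < v - δ - 1 := by linarith
    positivity
  rw [F, hrad, Real.sqrt_sq hnonneg, div_eq_iff hden]
  ring
end

section
/- Let G be a strongly regular graph on v vertices with degree δ < v - 1 and parameters λ and μ. If λ > (λ - μ + √((λ-μ)² + 4(δ-μ)))/2, then for every vertex u of G the neighbourhood graph G_u is connected. -/
open scoped Classical

open Matrix in
/-- The quadratic identity `A² = (k - μ) I + (ℓ - μ) A + μ J` for the adjacency matrix of a strongly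
regular graph, evaluated on a vector orthogonal to the all-ones vector. -/
theorem SimpleGraph.IsSRGWith.adjMatrix_mulVec_dotProduct_self {V : Type*} [Fintype V]
    [DecidableEq V] {G : SimpleGraph V} [DecidableRel G.Adj] {n k l m : ℕ}
    (h : G.IsSRGWith n k l m) {x : V → ℝ} (hx : ∑ z, x z = 0) :
    (G.adjMatrix ℝ *ᵥ x) ⬝ᵥ (G.adjMatrix ℝ *ᵥ x) =
      ((k : ℝ) - m) * (x ⬝ᵥ x) + ((l : ℝ) - m) * (x ⬝ᵥ (G.adjMatrix ℝ *ᵥ x)) := by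
  have hcompl : Gᶜ.adjMatrix ℝ *ᵥ x = -x - G.adjMatrix ℝ *ᵥ x := by
    have hJ : (Matrix.of 1 : Matrix V V ℝ) *ᵥ x = 0 := by
      ext w
      simp [mulVec, dotProduct, hx]
    rw [← G.one_add_adjMatrix_add_compl_adjMatrix_eq_of_one (α := ℝ), add_mulVec, add_mulVec,
      one_mulVec, G.compl_adjMatrix_eq_adjMatrix_compl ℝ] at hJ
    linear_combination hJ
  have hsq : G.adjMatrix ℝ *ᵥ (G.adjMatrix ℝ *ᵥ x) =
      ((k : ℝ) - m) • x + ((l : ℝ) - m) • (G.adjMatrix ℝ *ᵥ x) := by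
    rw [mulVec_mulVec, ← pow_two, h.matrix_eq, add_mulVec, add_mulVec, smul_mulVec, smul_mulVec,
      smul_mulVec, one_mulVec, hcompl]
    ext w
    simp
    ring
  have hsymm : (G.adjMatrix ℝ *ᵥ x) ⬝ᵥ (G.adjMatrix ℝ *ᵥ x) =
      x ⬝ᵥ (G.adjMatrix ℝ *ᵥ (G.adjMatrix ℝ *ᵥ x)) := by
    rw [dotProduct_mulVec x, ← mulVec_transpose, G.transpose_adjMatrix]
  rw [hsymm, hsq, dotProduct_add, dotProduct_smul, dotProduct_smul, smul_eq_mul, smul_eq_mul]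

open Matrix in
/-- If some nonzero function with sum zero is supported on the neighbourhood of `u` and constant
along the edges of the neighbourhood graph, then `μ (ℓ + 1) ≤ k`. -/
theorem SimpleGraph.IsSRGWith.mul_succ_le_of_locally_constant {V : Type*} [Fintype V]
    [DecidableEq V] {G : SimpleGraph V} [DecidableRel G.Adj] {n k l m : ℕ}
    (h : G.IsSRGWith n k l m) {u : V} {x : V → ℝ} (hx : ∑ z, x z = 0)
    (hsupp : ∀ z, ¬ G.Adj u z → x z = 0)
    (hadj : ∀ w z, G.Adj u w → G.Adj u z → G.Adj w z → x z = x w) (hne : x ≠ 0) :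
    (m : ℝ) * (l + 1) ≤ k := by
  have heig : ∀ w, G.Adj u w → (G.adjMatrix ℝ *ᵥ x) w = l * x w := by
    intro w hw
    have hcard : (G.neighborFinset w ∩ G.neighborFinset u).card = l := by
      rw [← h.of_adj w u hw.symm, ← Set.toFinset_card]
      congr 1
      ext z
      simp [mem_commonNeighbors]
    rw [adjMatrix_mulVec_apply, ← hcard, ← nsmul_eq_mul, ← Finset.sum_const]
    symm
    rw [← Finset.sum_subset Finset.inter_subset_left (f := x)]
    · refine Finset.sum_congr rfl fun z hz ↦ ?_
      simp only [Finset.mem_inter, mem_neighborFinset] at hz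
      exact (hadj w z hw hz.2 hz.1).symm
    · intro z hz hz'
      simp only [Finset.mem_inter, mem_neighborFinset] at hz hz'
      exact hsupp z fun hu ↦ hz' ⟨hz, hu⟩
  have hxA : x ⬝ᵥ (G.adjMatrix ℝ *ᵥ x) = l * (x ⬝ᵥ x) := by
    simp only [dotProduct, Finset.mul_sum]
    refine Finset.sum_congr rfl fun w _ ↦ ?_
    by_cases hw : G.Adj u w
    · rw [heig w hw]
      ring
    · simp [hsupp w hw]
  have hpos : 0 < x ⬝ᵥ x :=
    lt_of_le_of_ne (Finset.sum_nonneg fun z _ ↦ mul_self_nonneg _)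
      fun h0 ↦ hne (dotProduct_self_eq_zero.1 h0.symm)
  have hCS : (x ⬝ᵥ (G.adjMatrix ℝ *ᵥ x)) ^ 2 ≤
      (x ⬝ᵥ x) * ((G.adjMatrix ℝ *ᵥ x) ⬝ᵥ (G.adjMatrix ℝ *ᵥ x)) := by
    simpa only [dotProduct, ← pow_two] using
      Finset.sum_mul_sq_le_sq_mul_sq Finset.univ x (G.adjMatrix ℝ *ᵥ x)
  rw [h.adjMatrix_mulVec_dotProduct_self hx, hxA] at hCS
  have hfac : 0 ≤ (x ⬝ᵥ x) ^ 2 * ((k : ℝ) - m * (l + 1)) := by linarith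
  exact sub_nonneg.1 (nonneg_of_mul_nonneg_right hfac (by positivity))

/-- In a strongly regular graph with `k < μ (ℓ + 1)`, the neighbourhood graphs are preconnected. -/
theorem SimpleGraph.IsSRGWith.preconnected_nbhdGraph {V : Type*} [Fintype V]
    [DecidableEq V] {G : SimpleGraph V} [DecidableRel G.Adj] {n k l m : ℕ}
    (h : G.IsSRGWith n k l m) (hk : (k : ℝ) < m * (l + 1)) (u : V) :
    (nbhdGraph G u).Preconnected := by
  intro a b
  by_contra hab
  let S : Finset V :=
    {z | ∃ hz : G.Adj u z, (nbhdGraph G u).Reachable a ⟨z, hz⟩}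
  let x : V → ℝ := fun z ↦
    (if z ∈ S then (k : ℝ) else 0) - if z ∈ G.neighborFinset u then (S.card : ℝ) else 0
  have haS : (a : V) ∈ S := Finset.mem_filter.2 ⟨Finset.mem_univ _, a.2, .refl _⟩
  have hbS : (b : V) ∉ S := fun hb ↦ hab (Finset.mem_filter.1 hb).2.2
  refine hk.not_ge (h.mul_succ_le_of_locally_constant (u := u) (x := x) ?_ ?_ ?_ ?_)
  · simp only [x, Finset.sum_sub_distrib, Finset.sum_ite_mem, Finset.univ_inter, Finset.sum_const,
      card_neighborFinset_eq_degree, h.regular.degree_eq, nsmul_eq_mul]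
    ring
  · intro z hz
    have hzS : z ∉ S := fun hzS ↦ hz (Finset.mem_filter.1 hzS).2.1
    simp [x, hz, hzS]
  · intro w z hw hz hwz
    have hstep : (nbhdGraph G u).Adj ⟨w, hw⟩ ⟨z, hz⟩ := hwz
    have hS : z ∈ S ↔ w ∈ S := by
      simp only [S, Finset.mem_filter, Finset.mem_univ, true_and]
      exact ⟨fun ⟨_, hr⟩ ↦ ⟨hw, hr.trans hstep.symm.reachable⟩,
        fun ⟨_, hr⟩ ↦ ⟨hz, hr.trans hstep.reachable⟩⟩
    simp [x, hS, hw, hz]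
  · intro h0
    have hu : ∀ z : G.neighborSet u, (z : V) ∈ G.neighborFinset u := fun z ↦
      (G.mem_neighborFinset u z).2 z.2
    have hb : x b = 0 := congrFun h0 b
    have hcard : 0 < S.card := Finset.card_pos.2 ⟨_, haS⟩
    simp only [x, if_neg hbS, if_pos (hu b), zero_sub, neg_eq_zero, Nat.cast_eq_zero] at hb
    exact hcard.ne' hb

/-- if `λ > (λ - μ + √((λ-μ)² + 4(δ-μ)))/2` then the neighbourhood graph of
every vertex of the strongly regular graph is connected. -/
theorem srg_neighbourhood_connected {V : Type*} [Fintype V] [DecidableEq V]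
    (G : SimpleGraph V) (v δ l m : ℕ) (hsrg : G.IsSRGWith v δ l m)
    (hconn : G.Connected) (hm : 1 ≤ m) (hδv : (δ : ℤ) < (v : ℤ) - 1)
    (hl : ((l : ℝ) - (m : ℝ) +
        Real.sqrt (((l : ℝ) - (m : ℝ)) ^ 2 + 4 * ((δ : ℝ) - (m : ℝ)))) / 2 < (l : ℝ)) :
    ∀ u : V, (nbhdGraph G u).Connected := by
  intro u
  have hk : (δ : ℝ) < m * (l + 1) := by
    have hlt : Real.sqrt (((l : ℝ) - (m : ℝ)) ^ 2 + 4 * ((δ : ℝ) - (m : ℝ))) < l + m := by linarith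
    have := Real.lt_sq_of_sqrt_lt hlt
    linarith
  have hnt : Nontrivial V := by
    rw [← Fintype.one_lt_card_iff_nontrivial, hsrg.card]
    omega
  obtain ⟨w, hw⟩ := hconn.preconnected.exists_adj_of_nontrivial u
  have : Nonempty (G.neighborSet u) := ⟨⟨w, hw⟩⟩
  exact ⟨hsrg.preconnected_nbhdGraph hk u⟩
end

section
/- Let G be a strongly regular graph on v vertices with degree δ < v - 1 and parameters λ and μ, and suppose λ equals the second largest eigenvalue ν₂(G) of the adjacency matrix of G. Then for every vertex u of G, the number of vertices of every connected component of the neighbourhood graph G_u is divisible by λ + 1. -/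
open scoped Classical

open Matrix in
/-- On vectors of coordinate sum zero, the square of the adjacency matrix of a strongly regular
graph acts as a linear polynomial in the adjacency matrix. -/
theorem SimpleGraph.IsSRGWith.adjMatrix_mulVec_mulVec {V : Type*} [Fintype V] [DecidableEq V]
    {G : SimpleGraph V} [DecidableRel G.Adj] {v δ l m : ℕ} (h : G.IsSRGWith v δ l m)
    {z : V → ℝ} (hz : ∑ i, z i = 0) :
    G.adjMatrix ℝ *ᵥ (G.adjMatrix ℝ *ᵥ z) =
      ((δ : ℝ) - m) • z + ((l : ℝ) - m) • (G.adjMatrix ℝ *ᵥ z) := by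
  have hsq := h.matrix_eq (α := ℝ)
  have hone : 1 + G.adjMatrix ℝ + Gᶜ.adjMatrix ℝ = Matrix.of 1 := by
    ext i j
    by_cases hij : i = j <;> by_cases hadj : G.Adj i j <;> simp_all
  have hJ : (Matrix.of 1 : Matrix V V ℝ) *ᵥ z = 0 := by
    ext i
    simpa [Matrix.mulVec, dotProduct] using hz
  have hcompl : Gᶜ.adjMatrix ℝ *ᵥ z = -z - G.adjMatrix ℝ *ᵥ z := by
    rw [← hone, Matrix.add_mulVec, Matrix.add_mulVec, Matrix.one_mulVec] at hJ
    rw [← sub_eq_zero, ← hJ]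
    abel
  rw [Matrix.mulVec_mulVec, ← pow_two, hsq]
  simp only [Matrix.add_mulVec, Matrix.smul_mulVec, Matrix.one_mulVec, hcompl]
  ext i
  simp
  ring

open Matrix in
/-- If `l` is an eigenvalue of a strongly regular graph and `l < δ`, then `δ = m * (l + 1)`. -/
theorem SimpleGraph.IsSRGWith.degree_eq_of_mulVec_eq {V : Type*} [Fintype V] [DecidableEq V]
    {G : SimpleGraph V} [DecidableRel G.Adj] {v δ l m : ℕ} (h : G.IsSRGWith v δ l m)
    (hlt : l < δ) {z : V → ℝ} (hz0 : z ≠ 0)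
    (hz : G.adjMatrix ℝ *ᵥ z = (l : ℝ) • z) :
    δ = m * (l + 1) := by
  have hsum : ∑ i, z i = 0 := by
    have h1 : (1 : V → ℝ) ⬝ᵥ (G.adjMatrix ℝ *ᵥ z) = δ * ∑ i, z i := by
      rw [Matrix.dotProduct_mulVec]
      have : (1 : V → ℝ) ᵥ* G.adjMatrix ℝ = fun _ => (δ : ℝ) := by
        ext i
        simp [SimpleGraph.adjMatrix_vecMul_apply, h.regular.degree_eq]
      rw [this]
      simp [dotProduct, Finset.mul_sum]
    rw [hz, dotProduct_smul, one_dotProduct, smul_eq_mul] at h1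
    have h2 : ((δ : ℝ) - l) * ∑ i, z i = 0 := by linarith
    have h3 : (l : ℝ) < δ := by exact_mod_cast hlt
    exact (mul_eq_zero.mp h2).resolve_left (by linarith)
  obtain ⟨i, hi⟩ := Function.ne_iff.mp hz0
  have hquad := congrFun (h.adjMatrix_mulVec_mulVec hsum) i
  simp only [hz, Matrix.mulVec_smul, Pi.add_apply, Pi.smul_apply, smul_eq_mul] at hquad
  have hi' : z i ≠ 0 := hi
  have : (δ : ℝ) = m * (l + 1) := by
    apply mul_right_cancel₀ hi'
    linarith
  exact_mod_cast this

open Matrix in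
/-- In a strongly regular graph with `δ = m * (l + 1)`, a vector of coordinate sum zero whose
Rayleigh quotient is `l` is an eigenvector. -/
theorem SimpleGraph.IsSRGWith.mulVec_eq_of_dotProduct_eq {V : Type*} [Fintype V]
    [DecidableEq V] {G : SimpleGraph V} [DecidableRel G.Adj] {v δ l m : ℕ}
    (h : G.IsSRGWith v δ l m) (hδ : δ = m * (l + 1)) {x : V → ℝ} (hx : ∑ i, x i = 0)
    (hray : x ⬝ᵥ (G.adjMatrix ℝ *ᵥ x) = l * (x ⬝ᵥ x)) :
    G.adjMatrix ℝ *ᵥ x = (l : ℝ) • x := by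
  have hsq : (G.adjMatrix ℝ *ᵥ x) ⬝ᵥ (G.adjMatrix ℝ *ᵥ x) =
      ((δ : ℝ) - m) * (x ⬝ᵥ x) + ((l : ℝ) - m) * (l * (x ⬝ᵥ x)) := by
    rw [← hray, Matrix.dotProduct_mulVec, ← Matrix.mulVec_transpose,
      SimpleGraph.transpose_adjMatrix, h.adjMatrix_mulVec_mulVec hx, add_dotProduct,
      smul_dotProduct, smul_dotProduct, smul_eq_mul, smul_eq_mul,
      dotProduct_comm (G.adjMatrix ℝ *ᵥ x) x]
  have hδ' : (δ : ℝ) = m * (l + 1) := by exact_mod_cast hδ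
  rw [← sub_eq_zero, ← dotProduct_self_eq_zero]
  simp only [sub_dotProduct, dotProduct_sub, smul_dotProduct, dotProduct_smul, smul_eq_mul,
    hsq, dotProduct_comm (G.adjMatrix ℝ *ᵥ x) x, hray, hδ']
  ring

/-- The second largest member of a family with at least two indices is a member. -/
theorem exists_eq_secondLargest {n : Type*} [Fintype n] [Nontrivial n] (f : n → ℝ) :
    ∃ i, f i = secondLargest f := by
  set s : Set ℝ := {x : ℝ | ∃ i j : n, i ≠ j ∧ x = min (f i) (f j)} with hs
  have hfin : s.Finite := by
    refine (Set.finite_range fun p : n × n => min (f p.1) (f p.2)).subset ?_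
    rintro x ⟨i, j, -, rfl⟩
    exact ⟨(i, j), rfl⟩
  have hne : s.Nonempty := by
    obtain ⟨i, j, hij⟩ := exists_pair_ne n
    exact ⟨_, i, j, hij, rfl⟩
  obtain ⟨i, j, -, hx⟩ := hne.csSup_mem hfin
  rcases min_choice (f i) (f j) with h | h
  · exact ⟨i, (hx.trans h).symm⟩
  · exact ⟨j, (hx.trans h).symm⟩

open Matrix in
/-- The second largest eigenvalue of a graph with at least two vertices has an eigenvector. -/
theorem exists_mulVec_eq_nu2_smul {V : Type*} [Fintype V] [DecidableEq V] [Nontrivial V]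
    (G : SimpleGraph V) : ∃ z : V → ℝ, z ≠ 0 ∧ G.adjMatrix ℝ *ᵥ z = nu2 G • z := by
  obtain ⟨i, hi⟩ := exists_eq_secondLargest (adjMatrix_isHermitian G).eigenvalues
  refine ⟨(adjMatrix_isHermitian G).eigenvectorBasis i, ?_, ?_⟩
  · intro h0
    apply (adjMatrix_isHermitian G).eigenvectorBasis.orthonormal.ne_zero i
    ext j
    exact congrFun h0 j
  · rw [nu2, ← hi]
    exact (adjMatrix_isHermitian G).mulVec_eigenvectorBasis i

open Matrix in
/-- Let `S` be a union of connected components of the neighbourhood graph of `u` in a strongly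
regular graph with `δ = m * (l + 1)`. A vertex `w` neither equal nor adjacent to `u` has
`m * #S / δ` neighbours in `S`. -/
theorem SimpleGraph.IsSRGWith.degree_mul_card_neighborFinset_inter {V : Type*} [Fintype V]
    [DecidableEq V] {G : SimpleGraph V} [DecidableRel G.Adj] {v δ l m : ℕ}
    (h : G.IsSRGWith v δ l m) (hδ : δ = m * (l + 1)) {u w : V} (huw : u ≠ w)
    (hadj : ¬G.Adj u w) {S : Finset V} (hS : S ⊆ G.neighborFinset u)
    (hclosed : ∀ a b, G.Adj u a → G.Adj u b → G.Adj a b → a ∈ S → b ∈ S) :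
    δ * (G.neighborFinset w ∩ S).card = S.card * m := by
  have hcommon (a : V) : (G.neighborFinset a ∩ G.neighborFinset u).card =
      Fintype.card (G.commonNeighbors u a) := by
    rw [← Set.toFinset_card]
    congr 1
    ext b
    simp [SimpleGraph.mem_commonNeighbors, and_comm]
  set x : V → ℝ := fun a =>
    δ * (if a ∈ S then 1 else 0) - S.card * (if a ∈ G.neighborFinset u then 1 else 0) with hx
  have hmul (a : V) : (G.adjMatrix ℝ *ᵥ x) a = δ * (G.neighborFinset a ∩ S).card -
      S.card * (G.neighborFinset a ∩ G.neighborFinset u).card := by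
    rw [SimpleGraph.adjMatrix_mulVec_apply]
    simp only [hx, Finset.sum_sub_distrib, ← Finset.mul_sum, Finset.sum_ite_mem,
      Finset.sum_const, nsmul_eq_mul, mul_one]
  have hsum : ∑ a, x a = 0 := by
    simp only [hx, Finset.sum_sub_distrib, ← Finset.mul_sum, Finset.sum_ite_mem,
      Finset.sum_const, nsmul_eq_mul, mul_one, Finset.univ_inter,
      SimpleGraph.card_neighborFinset_eq_degree, h.regular.degree_eq]
    ring
  have hlocal (a : V) (ha : G.Adj u a) : (G.adjMatrix ℝ *ᵥ x) a = l * x a := by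
    have hl : (G.neighborFinset a ∩ G.neighborFinset u).card = l := by
      rw [hcommon, h.of_adj u a ha]
    rw [hmul, hl]
    by_cases haS : a ∈ S
    · have : G.neighborFinset a ∩ S = G.neighborFinset a ∩ G.neighborFinset u := by
        ext b
        simp only [Finset.mem_inter, SimpleGraph.mem_neighborFinset]
        constructor
        · rintro ⟨hab, hb⟩
          exact ⟨hab, by simpa using hS hb⟩
        · rintro ⟨hab, hb⟩
          exact ⟨hab, hclosed a b ha hb hab haS⟩
      rw [this, hl]
      simp [hx, haS, ha]
      ring
    · have : G.neighborFinset a ∩ S = ∅ := by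
        ext b
        simp only [Finset.mem_inter, SimpleGraph.mem_neighborFinset, Finset.notMem_empty,
          iff_false, not_and]
        intro hab hb
        exact haS (hclosed b a (by simpa using hS hb) ha hab.symm hb)
      rw [this]
      simp [hx, haS, ha]
      ring
  have hzero (a : V) (ha : ¬G.Adj u a) : x a = 0 := by
    have : a ∉ S := fun haS => ha (by simpa using hS haS)
    simp [hx, this, ha]
  have hray : x ⬝ᵥ (G.adjMatrix ℝ *ᵥ x) = l * (x ⬝ᵥ x) := by
    simp only [dotProduct, Finset.mul_sum]
    refine Finset.sum_congr rfl fun a _ => ?_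
    by_cases ha : G.Adj u a
    · rw [hlocal a ha]
      ring
    · simp [hzero a ha]
  have hw := congrFun (h.mulVec_eq_of_dotProduct_eq hδ hsum hray) w
  rw [hmul, hcommon, h.of_not_adj huw hadj, Pi.smul_apply, hzero w hadj, smul_zero,
    sub_eq_zero] at hw
  exact_mod_cast hw

/-- if `λ = ν₂(G)` for a strongly regular graph `G`, then the number of vertices
of every connected component of every neighbourhood graph is divisible by `λ + 1`. -/
theorem srg_component_size_divisible {V : Type*} [Fintype V] [DecidableEq V]
    (G : SimpleGraph V) (v δ l m : ℕ) (hsrg : G.IsSRGWith v δ l m)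
    (hconn : G.Connected) (hm : 1 ≤ m) (hδv : (δ : ℤ) < (v : ℤ) - 1)
    (hl : (l : ℝ) = nu2 G) :
    ∀ u : V, ∀ C : (nbhdGraph G u).ConnectedComponent,
      (l + 1) ∣ C.supp.toFinset.card := by
  intro u C
  obtain ⟨c, hc⟩ := C.nonempty_supp
  have huc : G.Adj u c := c.2
  have : Nontrivial V := ⟨u, c, huc.ne⟩
  have hlt : l < δ := by
    rw [← hsrg.of_adj u c huc, ← hsrg.regular.degree_eq u]
    exact huc.card_commonNeighbors_lt_degree
  obtain ⟨z, hz0, hz⟩ := exists_mulVec_eq_nu2_smul G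
  have hδ : δ = m * (l + 1) := by
    rw [← hl] at hz
    exact hsrg.degree_eq_of_mulVec_eq hlt hz0 hz
  obtain ⟨w, hw⟩ : ∃ w, w ∉ insert u (G.neighborFinset u) := by
    by_contra! hall
    have h1 := Finset.card_insert_le u (G.neighborFinset u)
    rw [Finset.eq_univ_of_forall hall, Finset.card_univ, hsrg.card,
      SimpleGraph.card_neighborFinset_eq_degree, hsrg.regular.degree_eq] at h1
    omega
  simp only [Finset.mem_insert, SimpleGraph.mem_neighborFinset, not_or] at hw
  set S : Finset V := C.supp.toFinset.map (Function.Embedding.subtype _)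
  have hcount := hsrg.degree_mul_card_neighborFinset_inter hδ (Ne.symm hw.1) hw.2 (S := S)
    (by
      intro a ha
      obtain ⟨b, -, rfl⟩ := Finset.mem_map.mp ha
      exact (G.mem_neighborFinset u b).mpr b.2)
    (by
      intro a b _ hb hab ha
      obtain ⟨a, haC, rfl⟩ := Finset.mem_map.mp ha
      refine Finset.mem_map.mpr ⟨⟨b, hb⟩, ?_, rfl⟩
      have hab' : (nbhdGraph G u).Adj a ⟨b, hb⟩ := hab
      simp only [Set.mem_toFinset] at haC ⊢
      exact (C.mem_supp_congr_adj hab').mp haC)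
  rw [show S.card = C.supp.toFinset.card from Finset.card_map _] at hcount
  refine ⟨(G.neighborFinset w ∩ S).card,
    Nat.eq_of_mul_eq_mul_right hm (hcount.symm.trans ?_)⟩
  rw [hδ]
  ring
end

section
/- Let v ≥ 3 and 1 < δ < v - 1 be integers, and let S be a set of δ-regular simple graphs on v vertices. Let G ∈ S be a strongly regular graph with parameters (v, δ, λ, μ) satisfying λ ≥ (λ - μ + √((λ-μ)² + 4(δ-μ)))/2. Suppose that for every graph H ∈ S, every vertex u of H, and every connected component C of the neighbourhood graph H_u, the average degree of C is at least λ. Then for every H ∈ S, the algebraic connectivity of G is greater than or equal to the algebraic connectivity of H. -/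
open scoped Classical

open Matrix in
/-- The second smallest eigenvalue of a positive semidefinite matrix with a kernel vector `x` is
at most the Rayleigh quotient of any nonzero vector orthogonal to `x`. -/
theorem secondSmallest_eigenvalues_le {n : Type*} [Fintype n] [DecidableEq n]
    {A : Matrix n n ℝ} (hA : A.PosSemidef) {x y : n → ℝ} (hx : x ≠ 0) (hAx : A *ᵥ x = 0)
    (hy : y ≠ 0) (hxy : x ⬝ᵥ y = 0) {R : ℝ} (hR : y ⬝ᵥ A *ᵥ y ≤ R * (y ⬝ᵥ y)) :
    secondSmallest hA.1.eigenvalues ≤ R := by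
  set e := hA.1.eigenvalues with he
  have he0 : ∀ i, 0 ≤ e i := hA.eigenvalues_nonneg
  set U : n → n → ℝ := fun i => ⇑(hA.1.eigenvectorBasis i) with hU
  have hAU : ∀ i, A *ᵥ U i = e i • U i := hA.1.mulVec_eigenvectorBasis
  have hsum : ∀ a b : n → ℝ, a ⬝ᵥ b = ∑ i, (U i ⬝ᵥ a) * (U i ⬝ᵥ b) := by
    intro a b
    have := hA.1.eigenvectorBasis.sum_inner_mul_inner (WithLp.toLp 2 a) (WithLp.toLp 2 b)
    simp only [EuclideanSpace.inner_eq_star_dotProduct, star_trivial] at this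
    rw [dotProduct_comm a b, ← this]
    exact Finset.sum_congr rfl fun i _ => by rw [dotProduct_comm b]
  have hmul : ∀ i a, U i ⬝ᵥ A *ᵥ a = e i * (U i ⬝ᵥ a) := by
    intro i a
    have hT : Aᵀ = A := by
      have := hA.1
      rwa [IsHermitian, conjTranspose_eq_transpose_of_trivial] at this
    rw [dotProduct_mulVec, ← mulVec_transpose, hT, hAU, smul_dotProduct, smul_eq_mul]
  have hyy : 0 < y ⬝ᵥ y :=
    lt_of_le_of_ne (Finset.sum_nonneg fun i _ => mul_self_nonneg _)
      (fun h => hy (dotProduct_self_eq_zero.1 h.symm))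
  by_contra! hlt
  have hpair : ∀ i j, i ≠ j → R < max (e i) (e j) := by
    intro i j hij
    have hbdd : BddBelow {x : ℝ | ∃ i j : n, i ≠ j ∧ x = max (e i) (e j)} := by
      refine ⟨0, ?_⟩
      rintro _ ⟨k, l, -, rfl⟩
      exact le_max_of_le_left (he0 k)
    exact lt_of_lt_of_le hlt (csInf_le hbdd ⟨i, j, hij, rfl⟩)
  have hR0 : 0 ≤ R := by
    have h0 : 0 ≤ y ⬝ᵥ A *ᵥ y := by
      rw [hsum]
      refine Finset.sum_nonneg fun i _ => ?_
      rw [hmul, mul_left_comm]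
      exact mul_nonneg (he0 i) (mul_self_nonneg _)
    nlinarith
  have hker : ∀ i, e i = 0 ∨ U i ⬝ᵥ x = 0 := by
    intro i
    have := hmul i x
    rw [hAx, dotProduct_zero] at this
    exact mul_eq_zero.1 this.symm
  have hxx : x ⬝ᵥ x ≠ 0 := fun h => hx (dotProduct_self_eq_zero.1 h)
  obtain ⟨k, hk⟩ : ∃ k, U k ⬝ᵥ x ≠ 0 := by
    by_contra! h
    exact hxx (by rw [hsum]; simp [h])
  have hek : e k = 0 := (hker k).resolve_right hk
  have hbig : ∀ i, i ≠ k → R < e i := by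
    intro i hik
    have := hpair i k hik
    rwa [hek, max_eq_left (he0 i)] at this
  have hyk : U k ⬝ᵥ y = 0 := by
    have h := hsum x y
    rw [hxy, Finset.sum_eq_single k] at h
    · exact (mul_eq_zero.1 h.symm).resolve_left hk
    · intro i _ hik
      rw [(hker i).resolve_left (hR0.trans_lt (hbig i hik)).ne', zero_mul]
    · simp
  obtain ⟨j, hj⟩ : ∃ j, U j ⬝ᵥ y ≠ 0 := by
    by_contra! h
    exact hyy.ne' (by rw [hsum]; simp [h])
  refine absurd hR (not_le.2 ?_)
  rw [hsum, hsum, Finset.mul_sum]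
  have hterm : ∀ i, i ≠ k → R * ((U i ⬝ᵥ y) * (U i ⬝ᵥ y)) ≤ (U i ⬝ᵥ y) * (U i ⬝ᵥ A *ᵥ y) := by
    intro i hik
    rw [hmul, mul_left_comm (U i ⬝ᵥ y)]
    exact mul_le_mul_of_nonneg_right (hbig i hik).le (mul_self_nonneg _)
  refine Finset.sum_lt_sum (fun i _ => ?_) ⟨j, Finset.mem_univ _, ?_⟩
  · by_cases hik : i = k
    · simp [hik, hyk]
    · exact hterm i hik
  · have hjk : j ≠ k := fun h => hj (h ▸ hyk)
    rw [hmul, mul_left_comm (U j ⬝ᵥ y)]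
    exact mul_lt_mul_of_pos_right (hbig j hjk) (mul_self_pos.2 hj)

open Matrix in
/-- The Laplacian of a regular graph in terms of its adjacency matrix. -/
theorem lapMatrix_mulVec_of_regular {V : Type*} [Fintype V] [DecidableEq V] {H : SimpleGraph V}
    {d : ℕ} (hH : H.IsRegularOfDegree d) (x : V → ℝ) :
    H.lapMatrix ℝ *ᵥ x = (d : ℝ) • x - H.adjMatrix ℝ *ᵥ x := by
  ext w
  simp [SimpleGraph.lapMatrix_mulVec_apply, hH w]

open Matrix in
/-- The Laplacian quadratic form of a regular graph on a vector that is constant on a vertex `u`,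
on the neighbours of `u`, and on the non-neighbours of `u`. -/
theorem dotProduct_lapMatrix_mulVec_single_add_nbhd {V : Type*} [Fintype V] [DecidableEq V]
    {H : SimpleGraph V} {d : ℕ} (hH : H.IsRegularOfDegree d) (u : V) (p q b : ℝ) :
    (p • Pi.single u 1 + q • H.adjMatrix ℝ u + b • (1 : V → ℝ)) ⬝ᵥ
      H.lapMatrix ℝ *ᵥ (p • Pi.single u 1 + q • H.adjMatrix ℝ u + b • (1 : V → ℝ)) =
    d * (p ^ 2 - 2 * p * q + q ^ 2 * d) -
      q ^ 2 * (H.adjMatrix ℝ u ⬝ᵥ H.adjMatrix ℝ *ᵥ H.adjMatrix ℝ u) := by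
  set A := H.adjMatrix ℝ with hA
  set e : V → ℝ := Pi.single u 1 with he
  have hAe : A *ᵥ e = A u := by
    ext w; simp [he, hA, SimpleGraph.adj_comm]
  have hA1 : A *ᵥ (1 : V → ℝ) = (d : ℝ) • 1 := by
    ext w; simp [hA, hH w]
  have h1A : ∀ x : V → ℝ, (1 : V → ℝ) ⬝ᵥ A *ᵥ x = d * (1 ⬝ᵥ x) := by
    intro x
    rw [dotProduct_mulVec, ← mulVec_transpose, hA, SimpleGraph.transpose_adjMatrix, ← hA, hA1,
      smul_dotProduct, smul_eq_mul]
  have heA : ∀ x : V → ℝ, e ⬝ᵥ A *ᵥ x = A u ⬝ᵥ x := by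
    intro x
    rw [dotProduct_mulVec, ← mulVec_transpose, hA, SimpleGraph.transpose_adjMatrix, ← hA, hAe]
  have hee : e ⬝ᵥ e = 1 := by simp [he]
  have heχ : e ⬝ᵥ A u = 0 := by simp [he, hA]
  have hχe : A u ⬝ᵥ e = 0 := by simp [he, hA]
  have h1e : (1 : V → ℝ) ⬝ᵥ e = 1 := by simp [he]
  have h1χ : (1 : V → ℝ) ⬝ᵥ A u = d := by simp [hA, hH u]
  have hχχ : A u ⬝ᵥ A u = d := by
    rw [hA, SimpleGraph.adjMatrix_dotProduct, Finset.sum_congr rfl (g := fun _ => (1 : ℝ))]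
    · simp [hH u]
    · intro w hw; simpa using hw
  rw [lapMatrix_mulVec_of_regular hH, ← hA]
  simp only [mulVec_add, mulVec_smul, dotProduct_add, add_dotProduct, dotProduct_sub,
    smul_dotProduct, dotProduct_smul, smul_eq_mul, hA1, hAe, h1A, heA, hee, heχ, hχe, h1e, h1χ,
    hχχ]
  rw [dotProduct_comm e 1, dotProduct_comm (A u) 1, h1e, h1χ]
  ring

/-- If every connected component of a finite graph has average degree at least `l`, then its
degree sum is at least `l` times its order. -/
theorem mul_card_le_sum_degree_of_le_compAvgDegree {W : Type*} [Fintype W] (K : SimpleGraph W)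
    {l : ℝ} (h : ∀ C : K.ConnectedComponent, l ≤ compAvgDegree K C) :
    l * Fintype.card W ≤ ∑ w, (K.degree w : ℝ) := by
  have hC : ∀ C : K.ConnectedComponent,
      l * (C.supp.toFinset.card : ℝ) ≤ ∑ w ∈ C.supp.toFinset, (K.degree w : ℝ) := by
    intro C
    have hpos : (0 : ℝ) < C.supp.toFinset.card := by
      obtain ⟨w, hw⟩ := C.nonempty_supp
      exact_mod_cast Finset.card_pos.2 ⟨w, Set.mem_toFinset.2 hw⟩
    have hl := h C
    unfold compAvgDegree at hl
    exact (le_div_iff₀ hpos).1 hl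
  have hfib : ∀ f : W → ℝ,
      ∑ C : K.ConnectedComponent, ∑ w ∈ C.supp.toFinset, f w = ∑ w, f w := by
    intro f
    rw [← Finset.sum_fiberwise Finset.univ K.connectedComponentMk f]
    refine Finset.sum_congr rfl fun C _ => Finset.sum_congr ?_ fun _ _ => rfl
    ext w
    simp [SimpleGraph.ConnectedComponent.mem_supp_iff]
  have hle := Finset.sum_le_sum fun C (_ : C ∈ Finset.univ) => hC C
  rw [hfib, ← Finset.mul_sum] at hle
  have hcard : ∑ C : K.ConnectedComponent, (C.supp.toFinset.card : ℝ) = Fintype.card W := by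
    simpa using hfib fun _ => 1
  rwa [hcard] at hle

open Matrix in
/-- The degree sum of the neighbourhood graph of `u` in terms of the adjacency matrix. -/
theorem sum_degree_nbhdGraph {V : Type*} [Fintype V] (H : SimpleGraph V) (u : V) :
    ∑ w, ((nbhdGraph H u).degree w : ℝ) =
      H.adjMatrix ℝ u ⬝ᵥ H.adjMatrix ℝ *ᵥ H.adjMatrix ℝ u := by
  have hsub : ∀ f : V → ℝ, ∑ w : H.neighborSet u, f w = ∑ w ∈ H.neighborFinset u, f w := by
    intro f
    exact (Finset.sum_subtype _ (fun w => by simp) f).symm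
  rw [SimpleGraph.adjMatrix_dotProduct, ← hsub]
  refine Finset.sum_congr rfl fun w _ => ?_
  rw [mulVec, dotProduct_comm, SimpleGraph.adjMatrix_dotProduct, ← hsub]
  convert SimpleGraph.degree_eq_sum_if_adj (nbhdGraph H u) (R := ℝ) w using 1
  exact Finset.sum_congr rfl fun x _ => by simp

open Matrix in
/-- If every connected component of the neighbourhood graph of `u` has average degree at least
`l`, then the whole neighbourhood graph has degree sum at least `l` times its order. -/
theorem mul_degree_le_of_le_compAvgDegree {V : Type*} [Fintype V] (H : SimpleGraph V) (u : V)
    {l : ℝ} (h : ∀ C : (nbhdGraph H u).ConnectedComponent, l ≤ compAvgDegree (nbhdGraph H u) C) :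
    l * H.degree u ≤ H.adjMatrix ℝ u ⬝ᵥ H.adjMatrix ℝ *ᵥ H.adjMatrix ℝ u := by
  rw [← sum_degree_nbhdGraph, ← H.card_neighborSet_eq_degree u]
  convert mul_card_le_sum_degree_of_le_compAvgDegree (nbhdGraph H u) h

open Matrix in
/-- An eigenvalue `t` of a strongly regular graph with an eigenvector orthogonal to the all-ones
vector is a root of `t ^ 2 = (l - m) * t + (d - m)`. -/
theorem SimpleGraph.IsSRGWith.sq_eq_of_mulVec_eq {V : Type*} [Fintype V] [DecidableEq V]
    {G : SimpleGraph V} {n d l m : ℕ} (h : G.IsSRGWith n d l m) {x : V → ℝ} {s t : ℝ} (hx : x ≠ 0)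
    (ht : G.adjMatrix ℝ *ᵥ x = t • x) (hs : (of fun _ _ => 1 : Matrix V V ℝ) *ᵥ x = s • x) :
    t ^ 2 = d + l * t + m * (s - 1 - t) := by
  have hc : Gᶜ.adjMatrix ℝ = (of fun _ _ => 1 : Matrix V V ℝ) - 1 - G.adjMatrix ℝ := by
    ext i j
    by_cases hij : i = j
    · simp [hij]
    · by_cases ha : G.Adj i j <;> simp [hij, ha]
  have hm := congrArg (· *ᵥ x) (h.matrix_eq (α := ℝ))
  simp only [hc, pow_two, ← mulVec_mulVec, ht, mulVec_smul, add_mulVec, sub_mulVec, smul_mulVec,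
    hs, one_mulVec] at hm
  obtain ⟨w, hw⟩ := Function.ne_iff.1 hx
  have := congrFun hm w
  simp only [← Nat.cast_smul_eq_nsmul ℝ, Pi.add_apply, Pi.sub_apply, Pi.smul_apply,
    smul_eq_mul] at this
  refine mul_right_cancel₀ (b := x w) hw ?_
  linear_combination this

/-- In a graph with more than `d + 1` vertices, the parameter `m` of a strongly regular graph of
degree `d` is at most `d`. -/
theorem SimpleGraph.IsSRGWith.param_le {V : Type*} [Fintype V] [DecidableEq V]
    {G : SimpleGraph V} {n d l m : ℕ} (h : G.IsSRGWith n d l m) (hd : d + 1 < n) : m ≤ d := by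
  obtain ⟨u⟩ : Nonempty V := Fintype.card_pos_iff.1 (by rw [h.card]; omega)
  obtain ⟨w, hw⟩ : ∃ w, w ∉ insert u (G.neighborFinset u) := by
    by_contra! hall
    have hle : (Finset.univ : Finset V).card ≤ _ := Finset.card_le_card fun w _ => hall w
    have := hle.trans (Finset.card_insert_le _ _)
    rw [Finset.card_univ, h.card, G.card_neighborFinset_eq_degree, h.regular u] at this
    omega
  simp only [Finset.mem_insert, not_or, SimpleGraph.mem_neighborFinset] at hw
  rw [← h.of_not_adj (Ne.symm hw.1) hw.2, ← h.regular u]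
  exact G.card_commonNeighbors_le_degree_left u w

open Matrix in
/-- The algebraic connectivity of a connected strongly regular graph of degree `d` is at least
`d - θ`, where `θ` is the larger root of `t ^ 2 = (l - m) * t + (d - m)`. -/
theorem SimpleGraph.IsSRGWith.le_algebraicConnectivity {V : Type*} [Fintype V] [DecidableEq V]
    {G : SimpleGraph V} {n d l m : ℕ} (h : G.IsSRGWith n d l m) (hconn : G.Connected)
    (hn : 1 < n) :
    (d : ℝ) - ((l : ℝ) - m + Real.sqrt (((l : ℝ) - m) ^ 2 + 4 * ((d : ℝ) - m))) / 2 ≤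
      algebraicConnectivity G := by
  have hA := (SimpleGraph.posSemidef_lapMatrix ℝ G).1
  set e := hA.eigenvalues with he
  set U : V → V → ℝ := fun i => ⇑(hA.eigenvectorBasis i) with hU
  have hLU : ∀ i, G.lapMatrix ℝ *ᵥ U i = e i • U i := hA.mulVec_eigenvectorBasis
  have hUU : ∀ i j, U i ⬝ᵥ U j = if i = j then 1 else 0 := by
    intro i j
    have := orthonormal_iff_ite.1 hA.eigenvectorBasis.orthonormal i j
    rw [EuclideanSpace.inner_eq_star_dotProduct, star_trivial, dotProduct_comm] at this
    exact this
  have hU0 : ∀ i, U i ≠ 0 := fun i h0 => by simpa [h0] using hUU i i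
  have hne : ∀ i, e i ≠ 0 → (d : ℝ) -
      ((l : ℝ) - m + Real.sqrt (((l : ℝ) - m) ^ 2 + 4 * ((d : ℝ) - m))) / 2 ≤ e i := by
    intro i hi
    have h1 : (1 : V → ℝ) ⬝ᵥ U i = 0 := by
      have h2 : (1 : V → ℝ) ⬝ᵥ G.lapMatrix ℝ *ᵥ U i = 0 := by
        rw [dotProduct_mulVec, ← mulVec_transpose, (G.isSymm_lapMatrix ℝ).eq]
        have : G.lapMatrix ℝ *ᵥ 1 = 0 := SimpleGraph.lapMatrix_mulVec_const_eq_zero G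
        rw [this, zero_dotProduct]
      rw [hLU, dotProduct_smul, smul_eq_mul] at h2
      exact (mul_eq_zero.1 h2).resolve_left hi
    have ht : G.adjMatrix ℝ *ᵥ U i = ((d : ℝ) - e i) • U i := by
      have := hLU i
      rw [lapMatrix_mulVec_of_regular h.regular] at this
      rw [sub_smul, ← this, sub_sub_cancel]
    have hs : (of fun _ _ => 1 : Matrix V V ℝ) *ᵥ U i = (0 : ℝ) • U i := by
      ext w
      simpa [mulVec, dotProduct] using h1
    have hq := h.sq_eq_of_mulVec_eq (hU0 i) ht hs
    have hsq : 2 * ((d : ℝ) - e i) - (l - m) ≤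
        Real.sqrt (((l : ℝ) - m) ^ 2 + 4 * ((d : ℝ) - m)) :=
      Real.le_sqrt_of_sq_le (by linear_combination 4 * hq)
    linarith
  have hcard : 1 < Fintype.card V := h.card ▸ hn
  obtain ⟨i₀, j₀, hij₀⟩ := Fintype.one_lt_card_iff.1 hcard
  refine le_csInf ⟨_, i₀, j₀, hij₀, rfl⟩ ?_
  rintro _ ⟨i, j, hij, rfl⟩
  by_cases hi : e i = 0
  · by_cases hj : e j = 0
    · exfalso
      have hconst : ∀ k, e k = 0 → ∀ w, U k w = U k i₀ := by
        intro k hk w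
        have := hLU k
        rw [hk, zero_smul] at this
        exact (SimpleGraph.lapMatrix_mulVec_eq_zero_iff_forall_reachable G).1 this _ _
          (hconn.preconnected w i₀)
      have hnz : ∀ k, e k = 0 → U k i₀ ≠ 0 := fun k hk h0 =>
        hU0 k (funext fun w => (hconst k hk w).trans h0)
      have h0 := hUU i j
      rw [if_neg hij] at h0
      simp only [dotProduct, hconst i hi, hconst j hj, Finset.sum_const, Finset.card_univ,
        nsmul_eq_mul, mul_eq_zero, hnz i hi, hnz j hj, or_false, Nat.cast_eq_zero] at h0
      omega
    · exact le_max_of_le_right (hne j hj)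
  · exact le_max_of_le_left (hne i hi)

open Matrix in
/-- A regular graph whose neighbourhood graph at some vertex has average degree at least `l` has
algebraic connectivity at most `d - θ`, where `θ` is a root of `t ^ 2 = (l - m) * t + (d - m)` and
the parameters satisfy the feasibility identity of strongly regular graphs. -/
theorem algebraicConnectivity_le_of_mul_degree_le {V : Type*} [Fintype V] [DecidableEq V]
    {H : SimpleGraph V} {d : ℕ} (hH : H.IsRegularOfDegree d) (u : V) {l m θ : ℝ}
    (hd : 0 < d) (hdV : d + 1 < Fintype.card V)
    (hparam : (d : ℝ) ^ 2 = d + l * d + m * (Fintype.card V - 1 - d))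
    (hθ : θ ^ 2 = (l - m) * θ + (d - m))
    (h : l * H.degree u ≤ H.adjMatrix ℝ u ⬝ᵥ H.adjMatrix ℝ *ᵥ H.adjMatrix ℝ u) :
    algebraicConnectivity H ≤ d - θ := by
  rw [hH u] at h
  have hd' : (0 : ℝ) < d := by exact_mod_cast hd
  obtain ⟨k, hk⟩ : ∃ k : ℝ, k = Fintype.card V - 1 - d := ⟨_, rfl⟩
  have hk0 : 0 < k := by
    have : (d : ℝ) + 1 < Fintype.card V := by exact_mod_cast hdV
    linarith
  have hn : (Fintype.card V : ℝ) = k + 1 + d := by rw [hk]; ring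
  rw [← hk] at hparam
  obtain ⟨a, ha⟩ : ∃ a : ℝ, d * a = θ := ⟨θ / d, by field_simp⟩
  obtain ⟨b, hb⟩ : ∃ b : ℝ, k * b = -(1 + θ) := ⟨-(1 + θ) / k, by field_simp⟩
  have hχ1 : H.adjMatrix ℝ u ⬝ᵥ 1 = d := by simp [hH u]
  have hχχ : H.adjMatrix ℝ u ⬝ᵥ H.adjMatrix ℝ u = d := by
    rw [SimpleGraph.adjMatrix_dotProduct, Finset.sum_congr rfl (g := fun _ => (1 : ℝ))]
    · simp [hH u]
    · intro w hw; simpa using hw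
  have hχe : H.adjMatrix ℝ u ⬝ᵥ Pi.single u 1 = 0 := by simp
  have he1 : (Pi.single u 1 : V → ℝ) ⬝ᵥ 1 = 1 := by simp
  have hee : (Pi.single u 1 : V → ℝ) ⬝ᵥ Pi.single u 1 = 1 := by simp
  have h11 : (1 : V → ℝ) ⬝ᵥ 1 = k + 1 + d := by rw [← hn]; simp
  refine secondSmallest_eigenvalues_le (SimpleGraph.posSemidef_lapMatrix ℝ H) (x := 1)
    (y := (1 - b) • Pi.single u 1 + (a - b) • H.adjMatrix ℝ u + b • (1 : V → ℝ))
    (fun h1 => one_ne_zero (congrFun h1 u))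
    (SimpleGraph.lapMatrix_mulVec_const_eq_zero H) (fun h0 => ?_) ?_ ?_
  · simpa using congrFun h0 u
  · rw [dotProduct_comm]
    simp only [add_dotProduct, smul_dotProduct, hχ1, he1, h11, smul_eq_mul]
    linear_combination ha + hb
  · rw [dotProduct_lapMatrix_mulVec_single_add_nbhd hH]
    simp only [add_dotProduct, smul_dotProduct, dotProduct_add, dotProduct_smul, hχ1, he1, h11,
      hee, hχχ, hχe, dotProduct_comm _ (H.adjMatrix ℝ u), dotProduct_comm 1 (Pi.single u (1 : ℝ)),
      smul_eq_mul]
    have hT := mul_le_mul_of_nonneg_left h (sq_nonneg (a - b))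
    have hrest : m * (b - a) = (d - θ) * b := by
      refine mul_left_cancel₀ hk0.ne' ?_
      linear_combination (m - d + θ) * hb + a * hparam - (d - 1 - l) * ha - hθ
    have hnbr : (a - 1) + (d - 1 - l) * (a - b) = (d - θ) * a := by
      refine mul_left_cancel₀ hd'.ne' ?_
      linear_combination (θ - l) * ha - b * hparam - m * hb + hθ
    have hquad : d * (1 - a) ^ 2 + d * (d - 1 - l) * (a - b) ^ 2 =
        (d - θ) * (1 + d * a ^ 2 + k * b ^ 2) := by
      linear_combination d * a * hnbr + k * b * hrest - ha - b * (a - b) * hparam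
    linarith

/-- a strongly regular graph whose parameter `λ` satisfies
`λ ≥ (λ - μ + √((λ-μ)² + 4(δ-μ)))/2` and minimizes the average degree of the connected
components of all neighbourhood graphs in a class of `δ`-regular graphs on `v` vertices
maximizes the algebraic connectivity in that class. -/
theorem srg_maximizes_algebraic_connectivity (v δ l m : ℕ) (hv : 3 ≤ v)
    (hδ₁ : 1 < δ) (hδ₂ : (δ : ℤ) < (v : ℤ) - 1)
    (S : Set (SimpleGraph (Fin v))) (hS : ∀ H ∈ S, H.IsRegularOfDegree δ)
    (G : SimpleGraph (Fin v)) (hG : G ∈ S)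
    (hsrg : G.IsSRGWith v δ l m) (hconn : G.Connected) (hm : 1 ≤ m)
    (hl : ((l : ℝ) - (m : ℝ) +
        Real.sqrt (((l : ℝ) - (m : ℝ)) ^ 2 + 4 * ((δ : ℝ) - (m : ℝ)))) / 2 ≤ (l : ℝ))
    (hmin : ∀ H ∈ S, ∀ u : Fin v, ∀ C : (nbhdGraph H u).ConnectedComponent,
      (l : ℝ) ≤ compAvgDegree (nbhdGraph H u) C) :
    ∀ H ∈ S, algebraicConnectivity H ≤ algebraicConnectivity G := by
  intro H hH
  have hδv : δ + 1 < v := by omega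
  have hmδ : (m : ℝ) ≤ δ := by exact_mod_cast hsrg.param_le hδv
  refine le_trans ?_ (hsrg.le_algebraicConnectivity hconn (by omega))
  have hparam : (δ : ℝ) ^ 2 = δ + l * δ + m * (v - 1 - δ) := by
    have := hsrg.sq_eq_of_mulVec_eq (x := 1) (s := v) (t := δ)
      (fun h1 => one_ne_zero (congrFun h1 (⟨0, by omega⟩ : Fin v)))
      (by ext w; simp [hsrg.regular w]) (by ext w; simp [Matrix.mulVec, dotProduct])
    exact this
  have hsqrt := Real.sq_sqrt (show 0 ≤ ((l : ℝ) - m) ^ 2 + 4 * ((δ : ℝ) - m) from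
    add_nonneg (sq_nonneg _) (mul_nonneg (by norm_num) (sub_nonneg.2 hmδ)))
  refine algebraicConnectivity_le_of_mul_degree_le (hS H hH) (⟨0, by omega⟩ : Fin v) (l := l)
    (m := m) (by omega) (by simpa using hδv) (by simpa using hparam) ?_
    (mul_degree_le_of_le_compAvgDegree H _ (hmin H hH _))
  linear_combination hsqrt / 4
end

section
/- Let v ≥ 3 and 1 < δ < v - 1 be integers, and let G be a strongly regular graph with parameters (v, δ, λ, μ) such that v ≤ 2δ - λ and λ ≥ (λ - μ + √((λ-μ)² + 4(δ-μ)))/2. Then for every δ-regular simple graph H on v vertices, the algebraic connectivity of G is greater than or equal to the algebraic connectivity of H. -/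
open scoped Classical

namespace Matrix.IsHermitian

variable {n : Type*} [Fintype n] [DecidableEq n] {A : Matrix n n ℝ} (hA : A.IsHermitian)

theorem apply_eq_sum_eigenvalues (u w : n) :
    A u w = ∑ j, hA.eigenvalues j * (hA.eigenvectorBasis j u * hA.eigenvectorBasis j w) := by
  conv_lhs => rw [hA.spectral_theorem]
  rw [Unitary.conjStarAlgAut_apply, Matrix.mul_apply]
  refine Finset.sum_congr rfl fun j _ => ?_
  simp [Matrix.mul_diagonal, eigenvectorUnitary_apply]
  ring

theorem sum_eigenvectorBasis_mul (u w : n) :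
    ∑ j, hA.eigenvectorBasis j u * hA.eigenvectorBasis j w = (1 : Matrix n n ℝ) u w := by
  have h := congrFun (congrFun (Unitary.coe_mul_star_self hA.eigenvectorUnitary) u) w
  rw [← h, Matrix.mul_apply]
  exact Finset.sum_congr rfl fun j _ => by simp [eigenvectorUnitary_apply]

/-- If all eigenvalues but the one at `i` exceed `c`, then `A - c` is positive on nonzero vectors
`a e_u + b e_w` orthogonal to the eigenvector at `i`, so `A` cannot restrict to `c` times the
identity at two distinct indices `u` and `w`. -/
theorem exists_eigenvalues_le_of_diag_eq {c : ℝ} {u w : n} (huw : u ≠ w) (huu : A u u = c)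
    (hww : A w w = c) (h0 : A u w = 0) :
    ∃ i j, i ≠ j ∧ hA.eigenvalues i ≤ c ∧ hA.eigenvalues j ≤ c := by
  by_contra! hcon
  obtain ⟨i, hi⟩ : ∃ i, ∀ j, j ≠ i → c < hA.eigenvalues j := by
    by_cases h : ∃ i, hA.eigenvalues i ≤ c
    · obtain ⟨i, hi⟩ := h
      exact ⟨i, fun j hj => hcon i j hj.symm hi⟩
    · push Not at h
      exact ⟨u, fun j _ => h j⟩
  set f := hA.eigenvalues
  set x : n → n → ℝ := fun j a => hA.eigenvectorBasis j a
  have eu : ∑ j, x j u * x j u = 1 := by simpa using hA.sum_eigenvectorBasis_mul u u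
  have ew : ∑ j, x j w * x j w = 1 := by simpa using hA.sum_eigenvectorBasis_mul w w
  have euw : ∑ j, x j u * x j w = 0 := by
    simpa [Matrix.one_apply_ne huw] using hA.sum_eigenvectorBasis_mul u w
  have fu : ∑ j, f j * (x j u * x j u) = c := by rw [← huu, hA.apply_eq_sum_eigenvalues]
  have fw : ∑ j, f j * (x j w * x j w) = c := by rw [← hww, hA.apply_eq_sum_eigenvalues]
  have fuw : ∑ j, f j * (x j u * x j w) = 0 := by rw [← h0, hA.apply_eq_sum_eigenvalues]
  have key (a b : ℝ) (hab : a * x i u + b * x i w = 0) : a ^ 2 + b ^ 2 = 0 := by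
    have hsum : ∑ j, (f j - c) * (a * x j u + b * x j w) ^ 2 = 0 := by
      calc
        _ = a ^ 2 * (∑ j, f j * (x j u * x j u)) + 2 * a * b * (∑ j, f j * (x j u * x j w))
            + b ^ 2 * (∑ j, f j * (x j w * x j w)) - c * (a ^ 2 * (∑ j, x j u * x j u)
            + 2 * a * b * (∑ j, x j u * x j w) + b ^ 2 * (∑ j, x j w * x j w)) := by
          simp only [Finset.mul_sum, ← Finset.sum_add_distrib, ← Finset.sum_sub_distrib]
          exact Finset.sum_congr rfl fun j _ => by ring
        _ = 0 := by rw [eu, ew, euw, fu, fw, fuw]; ring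
    have hnonneg : ∀ j ∈ Finset.univ, 0 ≤ (f j - c) * (a * x j u + b * x j w) ^ 2 := by
      intro j _
      by_cases hj : j = i
      · simp [hj, hab]
      · exact mul_nonneg (sub_nonneg.2 (hi j hj).le) (sq_nonneg _)
    have hzero (j : n) : a * x j u + b * x j w = 0 := by
      by_cases hj : j = i
      · rw [hj, hab]
      · have h := (Finset.sum_eq_zero_iff_of_nonneg hnonneg).1 hsum j (Finset.mem_univ j)
        have hpos : f j - c ≠ 0 := (sub_pos.2 (hi j hj)).ne'
        simpa [hpos] using h
    calc
      a ^ 2 + b ^ 2 = a ^ 2 * (∑ j, x j u * x j u) + 2 * a * b * (∑ j, x j u * x j w)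
          + b ^ 2 * (∑ j, x j w * x j w) := by rw [eu, ew, euw]; ring
      _ = ∑ j, (a * x j u + b * x j w) ^ 2 := by
        simp only [Finset.mul_sum, ← Finset.sum_add_distrib]
        exact Finset.sum_congr rfl fun j _ => by ring
      _ = 0 := by simp [hzero]
  have hk := key (x i w) (-x i u) (by ring)
  have hu : x i u = 0 := by nlinarith [sq_nonneg (x i u), sq_nonneg (x i w)]
  simpa using key 1 0 (by simp [hu])

/-- Two orthonormal eigenvectors cannot both be constant. -/
theorem eq_of_eigenvectorBasis_const {i j : n} {a b : ℝ} (hi : ∀ u, hA.eigenvectorBasis i u = a)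
    (hj : ∀ u, hA.eigenvectorBasis j u = b) : i = j := by
  by_contra hij
  have ho := hA.eigenvectorBasis.inner_eq_zero hij
  have hni := hA.eigenvectorBasis.inner_eq_one i
  have hnj := hA.eigenvectorBasis.inner_eq_one j
  simp only [PiLp.inner_apply, hi, hj, RCLike.inner_apply, conj_trivial, Finset.sum_const,
    nsmul_eq_mul] at ho hni hnj
  have h : (Finset.card (Finset.univ : Finset n) * (b * a)) ^ 2 = (1 : ℝ) := by
    linear_combination (Finset.card (Finset.univ : Finset n) * (b * b) : ℝ) * hni + hnj
  rw [ho] at h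
  norm_num at h

end Matrix.IsHermitian

section SecondSmallest

variable {n : Type*} [Fintype n] {f : n → ℝ} {c : ℝ}

theorem secondSmallest_le {i j : n} (hij : i ≠ j) (hi : f i ≤ c) (hj : f j ≤ c) :
    secondSmallest f ≤ c := by
  have hfin : {x : ℝ | ∃ i j : n, i ≠ j ∧ x = max (f i) (f j)}.Finite :=
    (Set.finite_range fun p : n × n => max (f p.1) (f p.2)).subset <| by
      rintro x ⟨i, j, -, rfl⟩
      exact ⟨(i, j), rfl⟩
  exact (csInf_le hfin.bddBelow ⟨i, j, hij, rfl⟩).trans (max_le hi hj)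

theorem le_secondSmallest [Nontrivial n] (h : ∀ i j, f i < c → f j < c → i = j) :
    c ≤ secondSmallest f := by
  obtain ⟨i, j, hij⟩ := exists_pair_ne n
  refine le_csInf ⟨_, i, j, hij, rfl⟩ ?_
  rintro x ⟨i, j, hij, rfl⟩
  by_contra! hlt
  exact hij (h i j ((le_max_left _ _).trans_lt hlt) ((le_max_right _ _).trans_lt hlt))

end SecondSmallest

namespace SimpleGraph

open scoped Matrix

variable {V : Type*} [Fintype V] {G : SimpleGraph V} {v k l m : ℕ}

theorem IsSRGWith.le_of_add_le (h : G.IsSRGWith v k l m) (hk : k + 1 < v) (hv : v + l ≤ 2 * k) :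
    k ≤ m := by
  have hparam := h.param_eq G (by omega)
  have hle : (v - k - 1) * m ≤ (k - l - 1) * m := Nat.mul_le_mul_right m (by omega)
  rw [← hparam, mul_comm] at hle
  exact Nat.le_of_mul_le_mul_left hle (by omega)

variable [DecidableEq V]

theorem IsRegularOfDegree.exists_ne_not_adj (h : G.IsRegularOfDegree k)
    (hk : k + 1 < Fintype.card V) : ∃ u w, u ≠ w ∧ ¬G.Adj u w := by
  by_contra! hcon
  obtain ⟨u⟩ : Nonempty V := Fintype.card_pos_iff.1 (by omega)
  have hsub : Finset.univ.erase u ⊆ G.neighborFinset u := fun w hw => by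
    simpa using hcon u w (Finset.ne_of_mem_erase hw).symm
  have hcard := Finset.card_le_card hsub
  rw [Finset.card_erase_of_mem (Finset.mem_univ u), Finset.card_univ,
    G.card_neighborFinset_eq_degree, h u] at hcard
  omega

theorem IsRegularOfDegree.algebraicConnectivity_le (h : G.IsRegularOfDegree k)
    (hk : k + 1 < Fintype.card V) : algebraicConnectivity G ≤ k := by
  obtain ⟨u, w, huw, hadj⟩ := h.exists_ne_not_adj hk
  have hdiag (a : V) : G.lapMatrix ℝ a a = k := by
    simp [lapMatrix, degMatrix, h a]
  obtain ⟨i, j, hij, hi, hj⟩ :=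
    (posSemidef_lapMatrix ℝ G).1.exists_eigenvalues_le_of_diag_eq huw (hdiag u) (hdiag w)
      (by simp [lapMatrix, degMatrix, huw, hadj])
  exact secondSmallest_le hij hi hj

theorem IsSRGWith.eigenvector_apply (h : G.IsSRGWith v k l m) {x : V → ℝ} {t : ℝ}
    (hx : G.adjMatrix ℝ *ᵥ x = t • x) (u : V) :
    (t ^ 2 + (m - l) * t + (m - k)) * x u = m * ∑ w, x w := by
  have hc : (Gᶜ.adjMatrix ℝ *ᵥ x) u = ∑ w, x w - x u - t * x u := by
    have hone : 1 + G.adjMatrix ℝ + Gᶜ.adjMatrix ℝ = Matrix.of fun _ _ => 1 := by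
      ext a b
      obtain rfl | hab := eq_or_ne a b
      · simp
      · by_cases hadj : G.Adj a b <;> simp [hab, hadj]
    have hJ := congrFun (congrArg (· *ᵥ x) hone) u
    simp only [Matrix.add_mulVec, Matrix.one_mulVec, Pi.add_apply, hx, Pi.smul_apply,
      smul_eq_mul] at hJ
    have hJ' : ((Matrix.of fun _ _ => 1 : Matrix V V ℝ) *ᵥ x) u = ∑ w, x w := by
      simp [Matrix.mulVec, dotProduct]
    linarith
  have hsq := congrFun (congrArg (· *ᵥ x) (h.matrix_eq (α := ℝ))) u
  simp only [pow_two, ← Nat.cast_smul_eq_nsmul ℝ, ← Matrix.mulVec_mulVec, hx, Matrix.mulVec_smul, Matrix.add_mulVec,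
    Matrix.smul_mulVec, Matrix.one_mulVec, Pi.add_apply, Pi.smul_apply, hc, smul_eq_mul] at hsq
  linear_combination hsq

/-- The eigenvectors of `G.lapMatrix` for eigenvalues below `k` are constant. -/
theorem IsSRGWith.le_algebraicConnectivity_s16 [Nontrivial V] (h : G.IsSRGWith v k l m)
    (hkm : k ≤ m) (hlm : l ≤ m) : (k : ℝ) ≤ algebraicConnectivity G := by
  have hA := (posSemidef_lapMatrix ℝ G).1
  have hconst (i : V) (hi : hA.eigenvalues i < k) :
      ∃ a, ∀ u, hA.eigenvectorBasis i u = a := by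
    have hx : G.adjMatrix ℝ *ᵥ ⇑(hA.eigenvectorBasis i) =
        (k - hA.eigenvalues i) • ⇑(hA.eigenvectorBasis i) := by
      ext u
      have hL := congrFun (hA.mulVec_eigenvectorBasis i) u
      rw [lapMatrix_mulVec_apply, h.regular u] at hL
      simp only [adjMatrix_mulVec_apply, Pi.smul_apply, smul_eq_mul] at hL ⊢
      linear_combination -hL
    have ht : 0 < (k : ℝ) - hA.eigenvalues i := sub_pos.2 hi
    have hkm' : (0 : ℝ) ≤ m - k := sub_nonneg.2 (by exact_mod_cast hkm)
    have hlm' : (0 : ℝ) ≤ m - l := sub_nonneg.2 (by exact_mod_cast hlm)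
    exact ⟨_, fun u => eq_div_of_mul_eq (by positivity)
      ((mul_comm _ _).trans (h.eigenvector_apply hx u))⟩
  refine le_secondSmallest fun i j hi hj => ?_
  obtain ⟨a, ha⟩ := hconst i hi
  obtain ⟨b, hb⟩ := hconst j hj
  exact hA.eq_of_eigenvectorBasis_const ha hb

end SimpleGraph

/-- a strongly regular graph with `v ≤ 2δ - λ` and
`λ ≥ (λ - μ + √((λ-μ)² + 4(δ-μ)))/2` maximizes the algebraic connectivity among all
`δ`-regular graphs on `v` vertices. -/
theorem srg_maximizes_algebraic_connectivity_of_v_le (v δ l m : ℕ) (hv : 3 ≤ v)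
    (hδ₁ : 1 < δ) (hδ₂ : (δ : ℤ) < (v : ℤ) - 1)
    (G : SimpleGraph (Fin v)) (hsrg : G.IsSRGWith v δ l m)
    (hconn : G.Connected) (hm : 1 ≤ m)
    (hvδ : (v : ℤ) ≤ 2 * (δ : ℤ) - (l : ℤ))
    (hl : ((l : ℝ) - (m : ℝ) +
        Real.sqrt (((l : ℝ) - (m : ℝ)) ^ 2 + 4 * ((δ : ℝ) - (m : ℝ)))) / 2 ≤ (l : ℝ)) :
    ∀ H : SimpleGraph (Fin v), H.IsRegularOfDegree δ →
      algebraicConnectivity H ≤ algebraicConnectivity G := by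
  intro H hH
  have : Nontrivial (Fin v) := Fin.nontrivial_iff_two_le.2 (by omega)
  have hkm : δ ≤ m := hsrg.le_of_add_le (by omega) (by omega)
  exact (hH.algebraicConnectivity_le (by simpa using (by omega : δ + 1 < v))).trans
    (hsrg.le_algebraicConnectivity_s16 hkm (by omega))
end

section
/- Let α ≥ 2 and m ≥ 1 be integers with αm ≥ 4, and let K be the complete multipartite graph with α parts each of size m, on v = αm vertices. Then K is (α-1)m-regular, and for every (α-1)m-regular simple graph H on αm vertices, the algebraic connectivity of K is greater than or equal to the algebraic connectivity of H. -/
open scoped Classical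

namespace Matrix.IsHermitian

variable {n : Type*} [Fintype n] [DecidableEq n] {A : Matrix n n ℝ}

theorem dotProduct_eq_sum_eigenvectorBasis (hA : A.IsHermitian) (x y : n → ℝ) :
    x ⬝ᵥ y = ∑ i, (⇑(hA.eigenvectorBasis i) ⬝ᵥ x) * (⇑(hA.eigenvectorBasis i) ⬝ᵥ y) := by
  have h := hA.eigenvectorBasis.sum_inner_mul_inner (WithLp.toLp 2 x) (WithLp.toLp 2 y)
  simp only [EuclideanSpace.inner_eq_star_dotProduct, star_trivial] at h
  rw [dotProduct_comm x y, ← h]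
  exact Finset.sum_congr rfl fun i _ => by rw [dotProduct_comm y]

theorem eigenvectorBasis_dotProduct (hA : A.IsHermitian) (i j : n) :
    ⇑(hA.eigenvectorBasis i) ⬝ᵥ ⇑(hA.eigenvectorBasis j) = if i = j then 1 else 0 := by
  have h := orthonormal_iff_ite.mp hA.eigenvectorBasis.orthonormal i j
  rwa [EuclideanSpace.inner_eq_star_dotProduct, star_trivial, dotProduct_comm] at h

theorem eigenvectorBasis_dotProduct_mulVec (hA : A.IsHermitian) (i : n) (x : n → ℝ) :
    ⇑(hA.eigenvectorBasis i) ⬝ᵥ A *ᵥ x =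
      hA.eigenvalues i * (⇑(hA.eigenvectorBasis i) ⬝ᵥ x) := by
  have hT : Aᵀ = A := by rw [← conjTranspose_eq_transpose_of_trivial]; exact hA
  rw [dotProduct_mulVec, ← mulVec_transpose, hT, mulVec_eigenvectorBasis, smul_dotProduct,
    smul_eq_mul]

/-- One half of the Courant–Fischer principle for the second smallest eigenvalue: it is at most
any upper bound of the Rayleigh quotient on a plane. -/
theorem secondSmallest_eigenvalues_le (hA : A.IsHermitian) {c : ℝ} {x y : n → ℝ}
    (hxy : LinearIndependent ℝ ![x, y])
    (h : ∀ a b : ℝ, (a • x + b • y) ⬝ᵥ A *ᵥ (a • x + b • y) ≤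
      c * ((a • x + b • y) ⬝ᵥ (a • x + b • y))) :
    secondSmallest hA.eigenvalues ≤ c := by
  by_contra! hc
  rw [LinearIndependent.pair_iff] at hxy
  have hne : Nonempty n := by
    by_contra hn
    rw [not_nonempty_iff] at hn
    exact one_ne_zero (hxy 1 0 (Subsingleton.elim _ _)).1
  have hbdd : BddBelow {t : ℝ | ∃ i j : n, i ≠ j ∧
      t = max (hA.eigenvalues i) (hA.eigenvalues j)} := by
    refine (Set.Finite.subset (Set.finite_range
      fun p : n × n => max (hA.eigenvalues p.1) (hA.eigenvalues p.2)) ?_).bddBelow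
    rintro t ⟨i, j, -, rfl⟩
    exact ⟨(i, j), rfl⟩
  obtain ⟨i₀, hi₀⟩ := Finite.exists_min hA.eigenvalues
  have hlt : ∀ i, i ≠ i₀ → c < hA.eigenvalues i := fun i hi =>
    hc.trans_le ((csInf_le hbdd ⟨i, i₀, hi, rfl⟩).trans_eq (max_eq_left (hi₀ i)))
  set e := fun i => ⇑(hA.eigenvectorBasis i)
  obtain ⟨a, b, hab, h0⟩ : ∃ a b : ℝ, ¬(a = 0 ∧ b = 0) ∧ e i₀ ⬝ᵥ (a • x + b • y) = 0 := by
    by_cases hq : e i₀ ⬝ᵥ y = 0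
    · exact ⟨0, 1, by simp, by simpa using hq⟩
    · refine ⟨e i₀ ⬝ᵥ y, -(e i₀ ⬝ᵥ x), fun h => hq h.1, ?_⟩
      simp only [dotProduct_add, dotProduct_smul, smul_eq_mul]
      ring
  have hz := h a b
  refine hab (hxy a b ?_)
  set z := a • x + b • y
  have hterm : ∀ i, 0 ≤ (hA.eigenvalues i - c) * (e i ⬝ᵥ z) ^ 2 := by
    intro i
    rcases eq_or_ne i i₀ with rfl | hi
    · simp [h0]
    · exact mul_nonneg (sub_nonneg.2 (hlt i hi).le) (sq_nonneg _)
  have hsum : ∑ i, (hA.eigenvalues i - c) * (e i ⬝ᵥ z) ^ 2 = 0 := by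
    refine le_antisymm ?_ (Finset.sum_nonneg fun i _ => hterm i)
    rw [hA.dotProduct_eq_sum_eigenvectorBasis z (A *ᵥ z),
      hA.dotProduct_eq_sum_eigenvectorBasis z z, Finset.mul_sum, ← sub_nonpos,
      ← Finset.sum_sub_distrib] at hz
    refine le_trans (le_of_eq (Finset.sum_congr rfl fun i _ => ?_)) hz
    rw [hA.eigenvectorBasis_dotProduct_mulVec]
    ring
  have hcoord : ∀ i, e i ⬝ᵥ z = 0 := by
    intro i
    rcases eq_or_ne i i₀ with rfl | hi
    · exact h0
    · have := (Finset.sum_eq_zero_iff_of_nonneg fun i _ => hterm i).1 hsum i (Finset.mem_univ i)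
      simpa [(sub_pos.2 (hlt i hi)).ne'] using this
  have hzz := hA.dotProduct_eq_sum_eigenvectorBasis z z
  rw [Finset.sum_eq_zero fun i _ => by
    rw [show ⇑(hA.eigenvectorBasis i) ⬝ᵥ z = 0 from hcoord i, zero_mul]] at hzz
  exact dotProduct_self_eq_zero.1 hzz

/-- The other half of the Courant–Fischer principle for the second smallest eigenvalue: it is at
least any lower bound of the Rayleigh quotient on a hyperplane. -/
theorem le_secondSmallest_eigenvalues [Nontrivial n] (hA : A.IsHermitian) {c : ℝ} (u : n → ℝ)
    (h : ∀ x : n → ℝ, u ⬝ᵥ x = 0 → c * (x ⬝ᵥ x) ≤ x ⬝ᵥ A *ᵥ x) :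
    c ≤ secondSmallest hA.eigenvalues := by
  refine le_csInf ?_ ?_
  · obtain ⟨i, j, hij⟩ := exists_pair_ne n
    exact ⟨_, i, j, hij, rfl⟩
  rintro _ ⟨i, j, hij, rfl⟩
  by_contra! hc
  obtain ⟨hi, hj⟩ := max_lt_iff.1 hc
  set e := fun i => ⇑(hA.eigenvectorBasis i)
  obtain ⟨a, b, hab, h0⟩ : ∃ a b : ℝ, 0 < a ^ 2 + b ^ 2 ∧ u ⬝ᵥ (a • e i + b • e j) = 0 := by
    by_cases hq : u ⬝ᵥ e j = 0
    · exact ⟨0, 1, by simp, by simpa using hq⟩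
    · refine ⟨u ⬝ᵥ e j, -(u ⬝ᵥ e i), by positivity, ?_⟩
      simp only [dotProduct_add, dotProduct_smul, smul_eq_mul]
      ring
  have hz := h _ h0
  have hdot : ∀ k l, e k ⬝ᵥ e l = if k = l then 1 else 0 := hA.eigenvectorBasis_dotProduct
  have hmul : ∀ k, A *ᵥ e k = hA.eigenvalues k • e k := hA.mulVec_eigenvectorBasis
  simp only [mulVec_add, mulVec_smul, hmul, dotProduct_add, add_dotProduct, dotProduct_smul,
    smul_dotProduct, hdot, hij, hij.symm, if_true, if_false, smul_eq_mul] at hz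
  have hneg : (hA.eigenvalues i - c) * a ^ 2 + (hA.eigenvalues j - c) * b ^ 2 < 0 := by
    have ha := sq_nonneg a
    have hb := sq_nonneg b
    rcases ha.eq_or_lt with ha | ha
    · nlinarith
    · nlinarith
  nlinarith

end Matrix.IsHermitian

namespace SimpleGraph

open Matrix

variable {V : Type*} [Fintype V] [DecidableEq V]

theorem algebraicConnectivity_le (G : SimpleGraph V) {c : ℝ} (hc : 0 ≤ c) {x : V → ℝ} (hx : x ≠ 0)
    (hsum : ∑ v, x v = 0) (h : x ⬝ᵥ G.lapMatrix ℝ *ᵥ x ≤ c * (x ⬝ᵥ x)) :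
    algebraicConnectivity G ≤ c := by
  have hL1 : G.lapMatrix ℝ *ᵥ 1 = 0 := G.lapMatrix_mulVec_const_eq_zero
  have h1L (y : V → ℝ) : 1 ⬝ᵥ G.lapMatrix ℝ *ᵥ y = 0 := by
    rw [dotProduct_mulVec, ← mulVec_transpose, (G.isSymm_lapMatrix ℝ).eq, hL1, zero_dotProduct]
  have h1x : 1 ⬝ᵥ x = 0 := by rw [one_dotProduct, hsum]
  have hx1 : x ⬝ᵥ 1 = 0 := by rw [dotProduct_comm, h1x]
  have hxx : x ⬝ᵥ x ≠ 0 := mt dotProduct_self_eq_zero.1 hx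
  refine Matrix.IsHermitian.secondSmallest_eigenvalues_le _ (x := x) (y := 1) ?_ fun a b => ?_
  · rw [LinearIndependent.pair_iff]
    intro a b hab
    have ha : a = 0 := by
      have := congrArg (x ⬝ᵥ ·) hab
      simpa [dotProduct_add, hx1, hxx] using this
    refine ⟨ha, ?_⟩
    obtain ⟨v, -⟩ := Function.ne_iff.1 hx
    simpa [ha] using congrFun hab v
  · simp only [mulVec_add, mulVec_smul, hL1, dotProduct_add, add_dotProduct, dotProduct_smul,
      smul_dotProduct, h1L, h1x, hx1, smul_eq_mul, smul_zero, mul_zero, add_zero,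
      zero_add]
    have h1 : 0 ≤ (1 : V → ℝ) ⬝ᵥ 1 := by simp
    have h2 : 0 ≤ c * (b * (b * ((1 : V → ℝ) ⬝ᵥ 1))) := by
      rw [← mul_assoc b b]
      exact mul_nonneg hc (mul_nonneg (mul_self_nonneg b) h1)
    have h3 := mul_le_mul_of_nonneg_left h (mul_self_nonneg a)
    linarith

theorem le_algebraicConnectivity [Nontrivial V] (G : SimpleGraph V) {c : ℝ}
    (h : ∀ x : V → ℝ, ∑ v, x v = 0 → c * (x ⬝ᵥ x) ≤ x ⬝ᵥ G.lapMatrix ℝ *ᵥ x) :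
    c ≤ algebraicConnectivity G :=
  Matrix.IsHermitian.le_secondSmallest_eigenvalues _ 1 fun x hx =>
    h x (by rwa [one_dotProduct] at hx)

theorem algebraicConnectivity_le_of_isRegularOfDegree {G : SimpleGraph V} {k : ℕ}
    (hG : G.IsRegularOfDegree k) {u w : V} (huw : u ≠ w) :
    algebraicConnectivity G ≤ k + if G.Adj u w then 1 else 0 := by
  refine G.algebraicConnectivity_le (x := Pi.single u 1 - Pi.single w 1)
    (by positivity) (fun h => ?_) (by simp) ?_
  · simpa [huw] using congrFun h u
  · simp only [mulVec_sub, sub_dotProduct, dotProduct_sub, mulVec_single_one,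
      single_one_dotProduct, col_apply, lapMatrix, degMatrix, Matrix.sub_apply, diagonal_apply,
      adjMatrix_apply, hG.degree_eq, huw, huw.symm, G.adj_comm w u, Pi.single_apply, if_true,
      if_false, SimpleGraph.irrefl]
    linarith

theorem neighborFinset_completeMultipartiteGraph (α m : ℕ) (v : Σ _ : Fin α, Fin m)
    [Fintype ((completeMultipartiteGraph fun _ : Fin α => Fin m).neighborSet v)] :
    (completeMultipartiteGraph fun _ : Fin α => Fin m).neighborFinset v =
      ({v.1}ᶜ : Finset (Fin α)).sigma fun _ => Finset.univ := by
  ext w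
  simp [completeMultipartiteGraph, eq_comm]

theorem isRegularOfDegree_completeMultipartiteGraph (α m : ℕ)
    [(completeMultipartiteGraph fun _ : Fin α => Fin m).LocallyFinite] :
    (completeMultipartiteGraph fun _ : Fin α => Fin m).IsRegularOfDegree ((α - 1) * m) := by
  intro v
  rw [← card_neighborFinset_eq_degree, neighborFinset_completeMultipartiteGraph]
  simp [Finset.card_compl]

/-- The Laplacian quadratic form of a complete multipartite graph with equal parts, on vectors
whose entries sum to zero. -/
theorem dotProduct_lapMatrix_completeMultipartiteGraph_mulVec (α m : ℕ)
    {_ : DecidableRel (completeMultipartiteGraph fun _ : Fin α => Fin m).Adj}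
    {x : (Σ _ : Fin α, Fin m) → ℝ} (hx : ∑ v, x v = 0) :
    x ⬝ᵥ (completeMultipartiteGraph fun _ : Fin α => Fin m).lapMatrix ℝ *ᵥ x =
      ((α - 1) * m : ℕ) * (x ⬝ᵥ x) + ∑ i, (∑ j, x ⟨i, j⟩) ^ 2 := by
  have hN (v : Σ _ : Fin α, Fin m) :
      ∑ u ∈ (completeMultipartiteGraph fun _ : Fin α => Fin m).neighborFinset v, x u =
        -∑ j, x ⟨v.1, j⟩ := by
    rw [Fintype.sum_sigma, Fintype.sum_eq_add_sum_compl v.1] at hx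
    rw [neighborFinset_completeMultipartiteGraph, Finset.sum_sigma]
    linarith
  simp only [dotProduct, lapMatrix_mulVec_apply, hN,
    (isRegularOfDegree_completeMultipartiteGraph α m).degree_eq, sub_neg_eq_add, mul_add,
    Finset.sum_add_distrib]
  congr 1
  · rw [Finset.mul_sum]
    exact Finset.sum_congr rfl fun v _ => by ring
  · simp only [Fintype.sum_sigma, sq, Finset.sum_mul]

end SimpleGraph

/-- the complete multipartite graph with `α` parts of size `m` is
`(α-1)m`-regular and maximizes the algebraic connectivity among all `(α-1)m`-regular graphs
on `αm` vertices. -/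
theorem completeMultipartite_maximizes_algebraic_connectivity (α m : ℕ)
    (hα : 2 ≤ α) (hm : 1 ≤ m) (h4 : 4 ≤ α * m) :
    (SimpleGraph.completeMultipartiteGraph (fun _ : Fin α => Fin m)).IsRegularOfDegree ((α - 1) * m) ∧
    ∀ H : SimpleGraph (Fin (α * m)), H.IsRegularOfDegree ((α - 1) * m) →
      algebraicConnectivity H ≤
        algebraicConnectivity (SimpleGraph.completeMultipartiteGraph (fun _ : Fin α => Fin m)) := by
  have hcard : Fintype.card (Σ _ : Fin α, Fin m) = α * m := by simp
  have : Nontrivial (Σ _ : Fin α, Fin m) := Fintype.one_lt_card_iff_nontrivial.1 (by omega)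
  refine ⟨SimpleGraph.isRegularOfDegree_completeMultipartiteGraph α m, fun H hH => ?_⟩
  by_cases hadj : ∃ u w, u ≠ w ∧ ¬H.Adj u w
  · obtain ⟨u, w, huw, hn⟩ := hadj
    calc algebraicConnectivity H ≤ ((α - 1) * m : ℕ) := by
          simpa only [hn, if_false, add_zero] using
            SimpleGraph.algebraicConnectivity_le_of_isRegularOfDegree hH huw
      _ ≤ _ := SimpleGraph.le_algebraicConnectivity _ fun x hx => by
          rw [SimpleGraph.dotProduct_lapMatrix_completeMultipartiteGraph_mulVec α m hx]
          exact le_add_of_nonneg_right (Finset.sum_nonneg fun i _ => sq_nonneg _)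
  · push Not at hadj
    have htop : H = ⊤ := by
      ext u w
      exact ⟨H.ne_of_adj, hadj u w⟩
    let u : Fin (α * m) := ⟨0, by omega⟩
    let w : Fin (α * m) := ⟨1, by omega⟩
    have huw : u ≠ w := by simp [u, w]
    obtain rfl : m = 1 := by
      have hdeg : H.degree u = α * m - 1 := by
        subst htop
        convert SimpleGraph.complete_graph_degree u
        simp
      rw [hH.degree_eq, Nat.sub_mul, one_mul] at hdeg
      have := Nat.le_mul_of_pos_left m (by omega : 0 < α)
      omega
    calc algebraicConnectivity H ≤ ((α - 1) * 1 : ℕ) + 1 := by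
          simpa only [hadj u w huw, if_true] using
            SimpleGraph.algebraicConnectivity_le_of_isRegularOfDegree hH huw
      _ ≤ _ := SimpleGraph.le_algebraicConnectivity _ fun x hx => by
          rw [SimpleGraph.dotProduct_lapMatrix_completeMultipartiteGraph_mulVec α 1 hx, add_mul]
          simp [dotProduct, Fintype.sum_sigma, sq]
end
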